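/- arXiv:1706.08816 — 4 statements merged into one kernel-verified Lean document; each statement's English description precedes it below -/
import Mathlib

section
/- (Mellin–Barnes representation of the w₄ Kuznetsov kernel.) Let d ≥ 2 be an integer, let r ∈ ℂ with 0 < Re r < 1/6, let y₁ ∈ ℝ ∖ {0}, and set ε := sgn(y₁) and μ = (μ₁,μ₂,μ₃) := ((d−1)/2+r, −(d−1)/2+r, −2r). Then (−εi)^d · J_{w₄}(y₁,(μ₃,μ₁,μ₂)) · exp(−(εiπ/2)((d−1)/2−3r)) − (−εi)^d · J_{w₄}(y₁,(μ₁,μ₂,μ₃)) = 4π cos(π(d/2+3r)) · ((εi)^d/(4π²)) · (2π)^{−1} ∫_ℝ |8π³y₁|^{1−r−it} Q(d,it) Γ(it+3r) exp(ε(iπ/2)(it+3r)) dt. -/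
open Complex Real

/-- The power-series solution `J_{w₄}(y₁, a)`. Mathlib's `Complex.Gamma` vanishes at the
nonpositive integers, so the reciprocals of `Γ` at its poles are `0` as required. -/
noncomputable def Jw4 (y₁ : ℝ) (a₁ a₂ a₃ : ℂ) : ℂ :=
  ((|8 * Real.pi ^ 3 * y₁| : ℝ) : ℂ) ^ (1 - a₃) *
    ∑' n : ℕ,
      ((-8 * (Real.pi : ℂ) ^ 3 * Complex.I * (y₁ : ℂ)) ^ n *
        ((n.factorial : ℂ) * Complex.Gamma ((n : ℂ) + 1 + a₁ - a₃) *
          Complex.Gamma ((n : ℂ) + 1 + a₂ - a₃))⁻¹)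

/-- `Q(d, s) = Γ((d-1)/2 + s) / Γ((d+1)/2 - s)`. -/
noncomputable def Q (d : ℕ) (s : ℂ) : ℂ :=
  Complex.Gamma (((d : ℂ) - 1) / 2 + s) / Complex.Gamma (((d : ℂ) + 1) / 2 - s)

theorem norm_Gamma_half_add_mul_I_le (t : ℝ) :
    ‖Complex.Gamma (1 / 2 + t * I)‖ ≤ √(2 * π) * Real.exp (-(π * |t| / 2)) := by
  have h1 := Complex.Gamma_mul_Gamma_one_sub (1 / 2 + t * I)
  have h2 : (1 : ℂ) - (1 / 2 + t * I) = (starRingEnd ℂ) (1 / 2 + t * I) := by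
    apply Complex.ext <;> simp <;> norm_num
  rw [h2, Complex.Gamma_conj, Complex.mul_conj, Complex.normSq_eq_norm_sq] at h1
  have h3 : Complex.sin (π * (1 / 2 + t * I)) = (Real.cosh (π * t) : ℝ) := by
    rw [show (π : ℂ) * (1 / 2 + t * I) = (π * t : ℂ) * I + π / 2 by ring, Complex.sin_add_pi_div_two,
      Complex.cos_mul_I]
    push_cast; rfl
  rw [h3] at h1
  have h4 : ‖Complex.Gamma (1 / 2 + t * I)‖ ^ 2 = π / Real.cosh (π * t) := by exact_mod_cast h1
  have h5 : Real.exp (π * |t|) / 2 ≤ Real.cosh (π * t) := by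
    rw [← Real.cosh_abs, abs_mul, abs_of_pos Real.pi_pos, Real.cosh_eq]
    have := Real.exp_pos (-(π * |t|))
    linarith
  refine (sq_le_sq₀ (norm_nonneg _) (by positivity)).1 ?_
  rw [h4, mul_pow, Real.sq_sqrt (by positivity), ← Real.exp_nat_mul]
  rw [show ((2 : ℕ) : ℝ) * -(π * |t| / 2) = -(π * |t|) by push_cast; ring, Real.exp_neg]
  rw [div_le_iff₀ (Real.cosh_pos _)]
  have h6 := Real.exp_pos (π * |t|)
  calc π = 2 * π * (Real.exp (π * |t|))⁻¹ * (Real.exp (π * |t|) / 2) := by field_simp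
    _ ≤ _ := by gcongr

theorem norm_cpow_half_sub_self {s : ℂ} (hs : 0 < s.re) :
    ‖s ^ (1 / 2 - s)‖ = ‖s‖ ^ (1 / 2 - s.re) * Real.exp (s.im * s.arg) := by
  have h0 : s ≠ 0 := by rintro rfl; simp at hs
  rw [Complex.norm_cpow_of_ne_zero h0, div_eq_mul_inv, ← Real.exp_neg]
  norm_num
  left; ring

theorem im_mul_arg_le {s : ℂ} (hs : 0 < s.re) : s.im * s.arg ≤ π * |s.im| / 2 := by
  have h := (Complex.abs_arg_le_pi_div_two_iff).2 hs.le
  calc s.im * s.arg ≤ |s.im| * |s.arg| := by rw [← abs_mul]; exact le_abs_self _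
    _ ≤ |s.im| * (π / 2) := by gcongr
    _ = _ := by ring

theorem le_im_mul_arg {s : ℂ} (hs : 0 < s.re) : π * |s.im| / 2 - s.re ≤ s.im * s.arg := by
  have key : ∀ x y : ℝ, 0 < x → 0 < y → π / 2 * y - x ≤ y * Real.arctan (y / x) := by
    intro x y hx hy
    have h1 := Real.arctan_inv_of_pos (show 0 < y / x by positivity)
    have h2 : Real.arctan (y / x)⁻¹ ≤ (y / x)⁻¹ := by
      have h := Real.le_tan (Real.arctan_nonneg.2 (show 0 ≤ (y / x)⁻¹ by positivity))
        (Real.arctan_lt_pi_div_two _)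
      rwa [Real.tan_arctan] at h
    rw [h1, inv_div, le_div_iff₀ hy] at h2
    linarith
  have harg : s.arg = Real.arctan (s.im / s.re) := by
    have h := (Complex.abs_arg_lt_pi_div_two_iff).2 (Or.inl hs)
    rw [← Complex.tan_arg, Real.arctan_tan (abs_lt.1 h).1 (abs_lt.1 h).2]
  rw [harg]
  rcases lt_trichotomy s.im 0 with h | h | h
  · have := key s.re (-s.im) hs (by linarith)
    rw [neg_div, Real.arctan_neg] at this
    rw [abs_of_neg h]
    linarith
  · simp [h, hs.le]
  · have := key s.re s.im hs h
    rw [abs_of_pos h]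
    linarith

theorem norm_Gamma_le_Gamma_re {s : ℂ} (hs : 0 < s.re) : ‖Complex.Gamma s‖ ≤ Real.Gamma s.re := by
  rw [Complex.Gamma_eq_integral hs, Real.Gamma_eq_integral hs, Complex.GammaIntegral]
  refine (MeasureTheory.norm_integral_le_integral_norm _).trans_eq ?_
  refine MeasureTheory.setIntegral_congr_fun measurableSet_Ioi fun x hx => ?_
  simp only [norm_mul, Complex.norm_cpow_eq_rpow_re_of_pos hx]
  simp [Complex.norm_exp]

theorem norm_Gamma_mul_cpow_le {s : ℂ} (h1 : 1 / 2 ≤ s.re) (h2 : s.re ≤ 3 / 2) :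
    ‖Complex.Gamma s * s ^ (1 / 2 - s)‖ ≤ √(2 * π) := by
  have hpos : ∀ z : ℂ, 1 / 2 ≤ z.re → 0 < z.re := fun z hz => by linarith
  have hclos : closure (Complex.re ⁻¹' Set.Ioo (1 / 2 : ℝ) (3 / 2)) ⊆
      {z : ℂ | 1 / 2 ≤ z.re ∧ z.re ≤ 3 / 2} := by
    refine closure_minimal (fun z hz => ⟨hz.1.le, hz.2.le⟩) ?_
    exact (isClosed_le continuous_const Complex.continuous_re).inter
      (isClosed_le Complex.continuous_re continuous_const)
  have hhalf : ∀ z : ℂ, z.re = 1 / 2 → ‖Complex.Gamma z‖ * Real.exp (z.im * z.arg) ≤ √(2 * π) := by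
    intro z hz
    have e : z = 1 / 2 + z.im * I := by
      apply Complex.ext <;> simp [hz]
    have h := norm_Gamma_half_add_mul_I_le z.im
    rw [← e] at h
    calc ‖Complex.Gamma z‖ * Real.exp (z.im * z.arg)
        ≤ (√(2 * π) * Real.exp (-(π * |z.im| / 2))) * Real.exp (π * |z.im| / 2) := by
          gcongr
          exact im_mul_arg_le (hpos z hz.ge)
      _ = √(2 * π) := by rw [mul_assoc, ← Real.exp_add]; simp
  refine PhragmenLindelof.vertical_strip (a := 1 / 2) (b := 3 / 2)
    (f := fun s => Complex.Gamma s * s ^ (1 / 2 - s)) ?_ ?_ ?_ ?_ h1 h2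
  · refine DifferentiableOn.diffContOnCl fun z hz => DifferentiableAt.differentiableWithinAt ?_
    have hz0 := hpos z (hclos hz).1
    refine (Complex.differentiableAt_Gamma z fun m hm => ?_).mul ?_
    · rw [hm] at hz0
      simp at hz0
      linarith [(Nat.cast_nonneg m : (0 : ℝ) ≤ m)]
    · exact differentiableAt_id.cpow (by fun_prop) (Or.inl hz0)
  · obtain ⟨M, hM⟩ := (isCompact_Icc (a := (1 / 2 : ℝ)) (b := 3 / 2)).exists_bound_of_continuousOn
      (f := Real.Gamma) (fun x hx => (Real.differentiableAt_Gamma fun m hm => by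
        have := hx.1
        rw [hm] at this
        linarith [(Nat.cast_nonneg m : (0 : ℝ) ≤ m)]).continuousAt.continuousWithinAt)
    refine ⟨1, by rw [lt_div_iff₀ (by norm_num)]; linarith [Real.pi_gt_three], 2, ?_⟩
    refine Asymptotics.IsBigO.of_bound (M * 2) ?_
    refine Filter.Eventually.filter_mono inf_le_right ?_
    rw [Filter.eventually_principal]
    intro z hz
    have hz1 : 1 / 2 ≤ z.re := hz.1.le
    have hz2 : z.re ≤ 3 / 2 := hz.2.le
    have hz0 := hpos z hz1
    have hn : 1 / 2 ≤ ‖z‖ := hz1.trans (Complex.re_le_norm z)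
    have hM0 : 0 ≤ M := (norm_nonneg _).trans (hM _ ⟨hz1, hz2⟩)
    rw [norm_mul, norm_cpow_half_sub_self hz0, Real.norm_of_nonneg (Real.exp_pos _).le]
    have a1 : ‖Complex.Gamma z‖ ≤ M :=
      (norm_Gamma_le_Gamma_re hz0).trans ((le_abs_self _).trans (hM _ ⟨hz1, hz2⟩))
    have a2 : ‖z‖ ^ (1 / 2 - z.re) ≤ 2 := by
      calc ‖z‖ ^ (1 / 2 - z.re) ≤ (1 / 2 : ℝ) ^ (1 / 2 - z.re) :=
            Real.rpow_le_rpow_of_nonpos (by norm_num) hn (by linarith)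
        _ ≤ (1 / 2 : ℝ) ^ (-1 : ℝ) :=
            Real.rpow_le_rpow_of_exponent_ge (by norm_num) (by norm_num) (by linarith)
        _ = 2 := by rw [Real.rpow_neg_one]; norm_num
    have a3 : Real.exp (z.im * z.arg) ≤ Real.exp (2 * Real.exp (1 * |z.im|)) := by
      apply Real.exp_le_exp.2
      refine (im_mul_arg_le hz0).trans ?_
      have := Real.add_one_le_exp (1 * |z.im|)
      nlinarith [Real.pi_lt_four, abs_nonneg z.im]
    calc _ ≤ M * (2 * Real.exp (2 * Real.exp (1 * |z.im|))) := by gcongr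
      _ = _ := by ring
  · intro z hz
    rw [norm_mul, norm_cpow_half_sub_self (hpos z hz.ge), hz]
    simpa using hhalf z hz
  · intro z hz
    have hz0 : 0 < z.re := by rw [hz]; norm_num
    rw [norm_mul, norm_cpow_half_sub_self hz0, hz]
    have hw : (z - 1).re = 1 / 2 := by simp [hz]; norm_num
    have hw0 : z - 1 ≠ 0 := by intro h; rw [h] at hw; simp at hw
    have hG : Complex.Gamma z = (z - 1) * Complex.Gamma (z - 1) := by
      rw [← Complex.Gamma_add_one _ hw0]; simp
    have e : z - 1 = 1 / 2 + (z.im : ℂ) * I := by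
      apply Complex.ext <;> simp [hz]; norm_num
    have h := norm_Gamma_half_add_mul_I_le z.im
    rw [← e] at h
    have hle : ‖z - 1‖ ≤ ‖z‖ := by
      rw [Complex.norm_eq_sqrt_sq_add_sq, Complex.norm_eq_sqrt_sq_add_sq]
      apply Real.sqrt_le_sqrt
      rw [hw, hz]; simp; norm_num
    have hn : 0 < ‖z‖ := norm_pos_iff.2 (by rintro rfl; simp at hz0)
    rw [hG, norm_mul, show (1 / 2 - 3 / 2 : ℝ) = -1 by norm_num, Real.rpow_neg_one]
    calc ‖z - 1‖ * ‖Complex.Gamma (z - 1)‖ * (‖z‖⁻¹ * Real.exp (z.im * z.arg))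
        ≤ ‖z‖ * (√(2 * π) * Real.exp (-(π * |z.im| / 2))) *
            (‖z‖⁻¹ * Real.exp (π * |z.im| / 2)) := by
          gcongr
          exact im_mul_arg_le hz0
      _ = √(2 * π) * (Real.exp (-(π * |z.im| / 2)) * Real.exp (π * |z.im| / 2)) := by
          field_simp
      _ = √(2 * π) := by rw [← Real.exp_add]; simp

theorem norm_Gamma_le_of_re_mem {s : ℂ} (h1 : 1 / 2 ≤ s.re) (h2 : s.re ≤ 3 / 2) (h3 : 1 ≤ |s.im|) :
    ‖Complex.Gamma s‖ ≤
      √(2 * π) * Real.exp (3 / 2) * 3 * (|s.im| ^ (s.re - 1 / 2) * Real.exp (-(π * |s.im| / 2))) := by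
  have h0 : 0 < s.re := by linarith
  have h := norm_Gamma_mul_cpow_le h1 h2
  rw [norm_mul, norm_cpow_half_sub_self h0] at h
  have hi : |s.im| ≤ ‖s‖ := Complex.abs_im_le_norm s
  have hn : 0 < ‖s‖ := by linarith
  have hs3 : ‖s‖ ≤ 3 * |s.im| := by
    refine (Complex.norm_le_abs_re_add_abs_im s).trans ?_
    rw [abs_of_pos h0]; linarith
  have hE := Real.exp_le_exp.2 (le_im_mul_arg h0)
  have hp : ‖s‖ ^ (s.re - 1 / 2) ≤ 3 * |s.im| ^ (s.re - 1 / 2) := by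
    calc ‖s‖ ^ (s.re - 1 / 2) ≤ (3 * |s.im|) ^ (s.re - 1 / 2) :=
          Real.rpow_le_rpow hn.le hs3 (by linarith)
      _ = 3 ^ (s.re - 1 / 2) * |s.im| ^ (s.re - 1 / 2) :=
          Real.mul_rpow (by norm_num) (by linarith)
      _ ≤ 3 ^ (1 : ℝ) * |s.im| ^ (s.re - 1 / 2) := by
          gcongr
          · norm_num
          · linarith
      _ = _ := by rw [Real.rpow_one]
  have e1 : ‖s‖ ^ (1 / 2 - s.re) * ‖s‖ ^ (s.re - 1 / 2) = 1 := by
    rw [← Real.rpow_add hn]; simp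
  have e2 : Real.exp (s.im * s.arg) * Real.exp (-(s.im * s.arg)) = 1 := by
    rw [← Real.exp_add]; simp
  calc ‖Complex.Gamma s‖ = (‖Complex.Gamma s‖ * (‖s‖ ^ (1 / 2 - s.re) * Real.exp (s.im * s.arg))) *
        (‖s‖ ^ (s.re - 1 / 2) * Real.exp (-(s.im * s.arg))) := by
        rw [show ∀ g a b c d : ℝ, g * (a * b) * (c * d) = g * ((a * c) * (b * d)) by
          intros; ring, e1, e2]; simp
    _ ≤ √(2 * π) * ((3 * |s.im| ^ (s.re - 1 / 2)) *
          (Real.exp (3 / 2) * Real.exp (-(π * |s.im| / 2)))) := by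
        gcongr
        rw [← Real.exp_add]
        apply Real.exp_le_exp.2
        linarith [le_im_mul_arg h0]
    _ = _ := by ring

/-- Upper bound of Stirling type for `Γ`, uniform on vertical strips. -/
theorem exists_norm_Gamma_le (n : ℕ) : ∃ C : ℝ, 0 ≤ C ∧ ∀ s : ℂ, 1 / 2 - n ≤ s.re → s.re ≤ 3 / 2 + n →
    1 ≤ |s.im| →
      ‖Complex.Gamma s‖ ≤ C * (|s.im| ^ (s.re - 1 / 2) * Real.exp (-(π * |s.im| / 2))) := by
  induction n with
  | zero =>
    refine ⟨_, by positivity, fun s h1 h2 h3 => norm_Gamma_le_of_re_mem ?_ ?_ h3⟩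
    · simpa using h1
    · simpa using h2
  | succ n ih =>
    obtain ⟨C, hC, ih⟩ := ih
    refine ⟨C * (3 + n), by positivity, fun s h1 h2 h3 => ?_⟩
    have hn0 : (0 : ℝ) ≤ n := Nat.cast_nonneg n
    have hpos : 0 < |s.im| := by linarith
    push_cast at h1 h2
    by_cases ha : s.re < 1 / 2 - n
    · have h0 : s ≠ 0 := by rintro rfl; simp at h3; linarith
      have hG : Complex.Gamma s = Complex.Gamma (s + 1) / s := by
        rw [Complex.Gamma_add_one _ h0]; field_simp
      have h := ih (s + 1) (by simp; linarith) (by simp; linarith) (by simpa using h3)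
      simp only [add_re, one_re, add_im, one_im, add_zero] at h
      have hle : |s.im| ≤ ‖s‖ := Complex.abs_im_le_norm s
      have ep : |s.im| ^ (s.re + 1 - 1 / 2) = |s.im| ^ (s.re - 1 / 2) * |s.im| := by
        rw [← Real.rpow_add_one hpos.ne']; ring_nf
      rw [hG, norm_div, div_le_iff₀ (by linarith)]
      rw [ep] at h
      calc _ ≤ _ := h
        _ = C * 1 * (|s.im| ^ (s.re - 1 / 2) * Real.exp (-(π * |s.im| / 2))) * |s.im| := by ring
        _ ≤ _ := by gcongr; linarith
    by_cases hb : 3 / 2 + n < s.re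
    · have h0 : s - 1 ≠ 0 := by
        intro h
        rw [sub_eq_zero.1 h] at h3
        simp at h3; linarith
      have hG : Complex.Gamma s = (s - 1) * Complex.Gamma (s - 1) := by
        rw [← Complex.Gamma_add_one _ h0]; simp
      have h := ih (s - 1) (by simp; linarith) (by simp; linarith) (by simpa using h3)
      simp only [sub_re, one_re, sub_im, one_im, sub_zero] at h
      have hle : ‖s - 1‖ ≤ (3 + n) * |s.im| := by
        refine (Complex.norm_le_abs_re_add_abs_im _).trans ?_
        simp only [sub_re, one_re, sub_im, one_im, sub_zero]
        rw [abs_of_pos (by linarith)]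
        nlinarith
      have ep : |s.im| ^ (s.re - 1 / 2) = |s.im| ^ (s.re - 1 - 1 / 2) * |s.im| := by
        rw [← Real.rpow_add_one hpos.ne']; ring_nf
      rw [hG, norm_mul, ep]
      calc _ ≤ ((3 + n) * |s.im|) *
            (C * (|s.im| ^ (s.re - 1 - 1 / 2) * Real.exp (-(π * |s.im| / 2)))) := by gcongr
        _ = _ := by ring
    · refine (ih s (by linarith) (by linarith) h3).trans ?_
      have : C ≤ C * (3 + n) := le_mul_of_one_le_right hC (by linarith)
      gcongr

open Filter Topology MeasureTheory in
/-- `a / (a² + t²)` integrates to `π`. -/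
theorem integrable_div_sq_add_sq {a : ℝ} (ha : 0 < a) :
    Integrable (fun t : ℝ => a / (a ^ 2 + t ^ 2)) ∧ ∫ t : ℝ, a / (a ^ 2 + t ^ 2) = π := by
  have e : (fun t : ℝ => a / (a ^ 2 + t ^ 2)) = fun t : ℝ => a⁻¹ * (1 + (t / a) ^ 2)⁻¹ := by
    ext t
    field_simp
  rw [e]
  refine ⟨(integrable_inv_one_add_sq.comp_div ha.ne').const_mul _, ?_⟩
  rw [integral_const_mul, Measure.integral_comp_div (fun t : ℝ => (1 + t ^ 2)⁻¹),
    integral_univ_inv_one_add_sq, abs_of_pos ha]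
  simp [ha.ne']

open Filter Topology MeasureTheory in
theorem integral_inv_sub_inv {a b : ℝ} (ha : 0 < a) (hb : 0 < b) :
    Integrable (fun t : ℝ => ((b : ℂ) + t * I)⁻¹ - (-(a : ℂ) + t * I)⁻¹) ∧
      ∫ t : ℝ, (((b : ℂ) + t * I)⁻¹ - (-(a : ℂ) + t * I)⁻¹) = 2 * π := by
  have hne : ∀ x t : ℝ, x ≠ 0 → (x : ℂ) + t * I ≠ 0 := fun x t hx h => hx (by
    simpa using congrArg Complex.re h)
  obtain ⟨ia, va⟩ := integrable_div_sq_add_sq ha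
  obtain ⟨ib, vb⟩ := integrable_div_sq_add_sq hb
  have inv_eq : ∀ x t : ℝ, x ≠ 0 → ((x : ℂ) + t * I)⁻¹ =
      ((x / (x ^ 2 + t ^ 2) : ℝ) : ℂ) - ((t / (x ^ 2 + t ^ 2) : ℝ) : ℂ) * I := by
    intro x t hx
    have h1 := hne x t hx
    have h2 : ((x : ℂ) ^ 2 + t ^ 2) ≠ 0 := by
      have : x ^ 2 + t ^ 2 ≠ 0 := by positivity
      exact_mod_cast this
    push_cast
    field_simp
    linear_combination ((t : ℂ) ^ 2) * I_sq
  have hab : ∀ t : ℝ, ((b : ℂ) + t * I)⁻¹ - (-(a : ℂ) + t * I)⁻¹ =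
      ((b / (b ^ 2 + t ^ 2) + a / (a ^ 2 + t ^ 2) : ℝ) : ℂ) -
        ((t / (b ^ 2 + t ^ 2) - t / (a ^ 2 + t ^ 2) : ℝ) : ℂ) * I := by
    intro t
    have h := inv_eq (-a) t (by linarith)
    push_cast at h
    rw [h, inv_eq b t hb.ne']
    push_cast
    ring
  have iodd : Integrable (fun t : ℝ => t / (b ^ 2 + t ^ 2) - t / (a ^ 2 + t ^ 2)) := by
    refine ((ia.const_mul |a ^ 2 - b ^ 2|).div_const (b * a)).mono'
      (by fun_prop : Measurable _).aestronglyMeasurable (ae_of_all _ fun t => ?_)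
    have h1 : 0 < b ^ 2 + t ^ 2 := by positivity
    have h2 : 0 < a ^ 2 + t ^ 2 := by positivity
    have e : t / (b ^ 2 + t ^ 2) - t / (a ^ 2 + t ^ 2) =
        (a ^ 2 - b ^ 2) * (t / (b ^ 2 + t ^ 2) / (a ^ 2 + t ^ 2)) := by field_simp; ring
    have hle : |t| / (b ^ 2 + t ^ 2) ≤ 1 / b := by
      rw [div_le_div_iff₀ h1 hb, ← sq_abs t]
      nlinarith [sq_nonneg (|t| - b), abs_nonneg t]
    rw [e, norm_mul, Real.norm_eq_abs, Real.norm_eq_abs, abs_div, abs_div, abs_of_pos h1,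
      abs_of_pos h2]
    calc |a ^ 2 - b ^ 2| * (|t| / (b ^ 2 + t ^ 2) / (a ^ 2 + t ^ 2))
        ≤ |a ^ 2 - b ^ 2| * (1 / b / (a ^ 2 + t ^ 2)) := by gcongr
      _ = _ := by field_simp
  have vodd : ∫ t : ℝ, (t / (b ^ 2 + t ^ 2) - t / (a ^ 2 + t ^ 2)) = 0 := by
    have h := integral_neg_eq_self (fun t : ℝ => t / (b ^ 2 + t ^ 2) - t / (a ^ 2 + t ^ 2)) volume
    have e : (fun t : ℝ => -t / (b ^ 2 + (-t) ^ 2) - -t / (a ^ 2 + (-t) ^ 2)) =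
        fun t : ℝ => -(t / (b ^ 2 + t ^ 2) - t / (a ^ 2 + t ^ 2)) := by
      ext t; rw [neg_sq]; ring
    simp only [e, integral_neg] at h
    linarith
  simp_rw [hab]
  have i1 : Integrable (fun t : ℝ => ((b / (b ^ 2 + t ^ 2) + a / (a ^ 2 + t ^ 2) : ℝ) : ℂ)) :=
    (ib.add ia).ofReal
  have i2 : Integrable (fun t : ℝ =>
      ((t / (b ^ 2 + t ^ 2) - t / (a ^ 2 + t ^ 2) : ℝ) : ℂ) * I) := iodd.ofReal.mul_const I
  refine ⟨i1.sub i2, ?_⟩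
  rw [integral_sub i1 i2, integral_mul_const, integral_complex_ofReal, integral_complex_ofReal, vodd,
    integral_add ib ia, va, vb]
  push_cast
  ring

open Filter Topology MeasureTheory in
theorem tendsto_vertical_integral_inv_sub {a b : ℝ} {p : ℂ} (ha : a < p.re) (hb : p.re < b) :
    Tendsto (fun T : ℝ => (∫ t in -T..T, ((b : ℂ) + t * I - p)⁻¹) -
      ∫ t in -T..T, ((a : ℂ) + t * I - p)⁻¹) atTop (𝓝 (2 * π)) := by
  obtain ⟨hi, hv⟩ := integral_inv_sub_inv (sub_pos.2 ha) (sub_pos.2 hb)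
  have hi' := hi.comp_sub_right p.im
  have hv' := integral_sub_right_eq_self (μ := volume)
    (fun t : ℝ => (((b - p.re : ℝ) : ℂ) + t * I)⁻¹ - (-((p.re - a : ℝ) : ℂ) + t * I)⁻¹) p.im
  rw [hv] at hv'
  rw [← hv']
  refine (intervalIntegral_tendsto_integral hi' tendsto_neg_atTop_atBot tendsto_id).congr fun T => ?_
  have hc : ∀ x : ℝ, x ≠ p.re → Continuous fun t : ℝ => ((x : ℂ) + t * I - p)⁻¹ := by
    intro x hx
    refine Continuous.inv₀ (by fun_prop) fun t h => hx ?_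
    have := congrArg Complex.re h
    simp at this
    linarith
  rw [← intervalIntegral.integral_sub ((hc b hb.ne').intervalIntegrable _ _)
    ((hc a ha.ne).intervalIntegrable _ _)]
  refine intervalIntegral.integral_congr fun t _ => ?_
  have e : p = p.re + p.im * I := (Complex.re_add_im p).symm
  push_cast
  congr 2
  · linear_combination e
  · linear_combination e

open Filter Topology MeasureTheory in
theorem tendsto_vertical_sub_of_continuousOn {a b : ℝ} (hab : a ≤ b) {g : ℂ → ℂ} {S : Set ℂ}
    (hS : S.Countable) (hc : ContinuousOn g {z | a ≤ z.re ∧ z.re ≤ b})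
    (hd : ∀ z : ℂ, a < z.re → z.re < b → z ∉ S → DifferentiableAt ℂ g z)
    (h0 : ∀ ε > 0, ∃ T₀ : ℝ, ∀ z : ℂ, a ≤ z.re → z.re ≤ b → T₀ ≤ |z.im| → ‖g z‖ ≤ ε) :
    Tendsto (fun T : ℝ => (∫ t in -T..T, g (b + t * I)) - ∫ t in -T..T, g (a + t * I))
      atTop (𝓝 0) := by
  rw [Metric.tendsto_atTop]
  intro ε hε
  obtain ⟨T₀, hT⟩ := h0 (ε / (4 * (b - a + 1))) (by have : 0 < b - a + 1 := by linarith
                                                    positivity)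
  refine ⟨max T₀ 1, fun T hTT => ?_⟩
  have hT1 : 0 < T := lt_of_lt_of_le one_pos ((le_max_right _ _).trans hTT)
  have hT0 : T₀ ≤ |T| := by rw [abs_of_pos hT1]; exact (le_max_left _ _).trans hTT
  have key := Complex.integral_boundary_rect_eq_zero_of_differentiable_on_off_countable g
    (a + (-T : ℝ) * I) (b + T * I) S hS ?_ ?_
  · simp only [add_re, ofReal_re, mul_re, I_re, mul_zero, ofReal_im, I_im, mul_one, sub_self,
      add_zero, add_im, mul_im, zero_add] at key
    have hb1 : ‖∫ x : ℝ in a..b, g (x + (-T : ℝ) * I)‖ ≤ ε / (4 * (b - a + 1)) * |b - a| := by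
      refine intervalIntegral.norm_integral_le_of_norm_le_const fun x hx => ?_
      rw [Set.uIoc_of_le hab] at hx
      exact hT _ (by simpa using hx.1.le) (by simpa using hx.2) (by simpa using hT0)
    have hb2 : ‖∫ x : ℝ in a..b, g (x + T * I)‖ ≤ ε / (4 * (b - a + 1)) * |b - a| := by
      refine intervalIntegral.norm_integral_le_of_norm_le_const fun x hx => ?_
      rw [Set.uIoc_of_le hab] at hx
      exact hT _ (by simpa using hx.1.le) (by simpa using hx.2) (by simpa using hT0)
    have hle : ε / (4 * (b - a + 1)) * |b - a| ≤ ε / 4 := by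
      rw [abs_of_nonneg (by linarith), div_mul_eq_mul_div, div_le_div_iff₀ (by linarith) (by norm_num)]
      nlinarith
    rw [dist_zero_right]
    set V := (∫ t in -T..T, g (b + t * I)) - ∫ t in -T..T, g (a + t * I) with hV
    have e : I * V = (∫ x : ℝ in a..b, g (x + T * I)) - ∫ x : ℝ in a..b, g (x + (-T : ℝ) * I) := by
      simp only [smul_eq_mul] at key
      rw [hV]
      linear_combination key
    have : ‖V‖ = ‖I * V‖ := by simp
    rw [this, e]
    refine (norm_sub_le _ _).trans_lt ?_
    linarith
  · refine hc.mono fun z hz => ?_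
    have := hz.1
    simp [Set.uIcc_of_le hab] at this
    exact this
  · intro z hz
    have := hz.1.1
    simp [hab] at this
    exact hd z this.1 this.2 hz.2

open Filter Topology MeasureTheory in
/-- Shifting a vertical contour across finitely many simple poles. -/
theorem tendsto_vertical_sub_of_simple_poles {ι : Type*} {a b : ℝ} (hab : a ≤ b) {f : ℂ → ℂ}
    (s : Finset ι) (p R : ι → ℂ) (hinj : Set.InjOn p s)
    (hp : ∀ i ∈ s, a < (p i).re ∧ (p i).re < b)
    (hd : ∀ z : ℂ, a ≤ z.re → z.re ≤ b → (∀ i ∈ s, z ≠ p i) → DifferentiableAt ℂ f z)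
    (hR : ∀ i ∈ s, Tendsto (fun z => (z - p i) * f z) (𝓝[≠] (p i)) (𝓝 (R i)))
    (h0 : ∀ ε > 0, ∃ T₀ : ℝ, ∀ z : ℂ, a ≤ z.re → z.re ≤ b → T₀ ≤ |z.im| → ‖f z‖ ≤ ε) :
    Tendsto (fun T : ℝ => (∫ t in -T..T, f (b + t * I)) - ∫ t in -T..T, f (a + t * I))
      atTop (𝓝 (2 * π * ∑ i ∈ s, R i)) := by
  classical
  set P : ℂ → ℂ := fun z => ∑ i ∈ s, R i * (z - p i)⁻¹ with hP
  set g : ℂ → ℂ := fun z => f z - P z with hg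
  set S : Set ℂ := p '' s with hS
  have hSfin : S.Finite := s.finite_toSet.image p
  have hPd : ∀ z, z ∉ S → DifferentiableAt ℂ P z := fun z hz => by
    refine DifferentiableAt.fun_sum fun i hi => ?_
    have : z - p i ≠ 0 := sub_ne_zero.2 fun h => hz ⟨i, hi, h.symm⟩
    fun_prop (disch := assumption)
  have hgd : ∀ z : ℂ, a ≤ z.re → z.re ≤ b → z ∉ S → DifferentiableAt ℂ g z := fun z h1 h2 hz =>
    (hd z h1 h2 fun i hi h => hz ⟨i, hi, h.symm⟩).sub (hPd z hz)
  set G : ℂ → ℂ := fun z => if z ∈ S then limUnder (𝓝[≠] z) g else g z with hG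
  have hGg : ∀ z, z ∉ S → G z = g z := fun z hz => by simp [hG, hz]
  have hGev : ∀ z, ∀ᶠ w in 𝓝[≠] z, w ∉ S := fun z => by
    have h1 : IsClosed (S \ {z}) := (hSfin.subset Set.sdiff_subset).isClosed
    have h2 : (S \ {z})ᶜ ∈ 𝓝 z := h1.isOpen_compl.mem_nhds (by simp)
    filter_upwards [nhdsWithin_le_nhds h2, self_mem_nhdsWithin] with w hw hw' hwS
    exact hw ⟨hwS, hw'⟩
  have hGd : ∀ z : ℂ, a ≤ z.re → z.re ≤ b → z ∉ S → DifferentiableAt ℂ G z := fun z h1 h2 hz => by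
    refine (hgd z h1 h2 hz).congr_of_eventuallyEq ?_
    filter_upwards [hSfin.isClosed.isOpen_compl.mem_nhds hz] with w hw
    exact hGg w hw
  have hmul : ∀ i ∈ s, Tendsto (fun z => (z - p i) * g z) (𝓝[≠] (p i)) (𝓝 0) := by
    intro i hi
    have hsplit : ∀ z, z ≠ p i → (z - p i) * g z =
        (z - p i) * f z - (R i + (z - p i) * ∑ j ∈ s.erase i, R j * (z - p j)⁻¹) := by
      intro z hz
      have hz' : z - p i ≠ 0 := sub_ne_zero.2 hz
      simp only [hg, hP]
      rw [← Finset.add_sum_erase s _ hi]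
      field_simp
    have hrest : ContinuousAt (fun z => ∑ j ∈ s.erase i, R j * (z - p j)⁻¹) (p i) := by
      refine tendsto_finsetSum _ fun j hj => ?_
      have hj' := Finset.mem_erase.1 hj
      have : p i - p j ≠ 0 := sub_ne_zero.2 fun h => hj'.1 (hinj hj'.2 hi h.symm)
      exact ((continuousAt_id.sub continuousAt_const).inv₀ this).const_mul _
    have h1 : Tendsto (fun z => (z - p i) * ∑ j ∈ s.erase i, R j * (z - p j)⁻¹) (𝓝[≠] (p i))
        (𝓝 ((p i - p i) * ∑ j ∈ s.erase i, R j * (p i - p j)⁻¹)) :=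
      ((continuousAt_id.sub continuousAt_const).mul hrest).tendsto.mono_left nhdsWithin_le_nhds
    have h2 := (hR i hi).sub (h1.const_add (R i))
    simp only [sub_self, zero_mul, add_zero] at h2
    refine h2.congr' ?_
    filter_upwards [self_mem_nhdsWithin] with z hz
    exact (hsplit z hz).symm
  have hGc : ContinuousOn G {z | a ≤ z.re ∧ z.re ≤ b} := by
    intro z hz
    by_cases hzS : z ∈ S
    · obtain ⟨i, hi, rfl⟩ := hzS
      obtain ⟨hp1, hp2⟩ := hp i hi
      have hnhds : ∀ᶠ w in 𝓝[≠] (p i), DifferentiableAt ℂ g w := by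
        have h1 : ∀ᶠ w in 𝓝 (p i), a < w.re :=
          (isOpen_lt continuous_const Complex.continuous_re).mem_nhds hp1
        have h2 : ∀ᶠ w in 𝓝 (p i), w.re < b :=
          (isOpen_lt Complex.continuous_re continuous_const).mem_nhds hp2
        filter_upwards [hGev (p i), nhdsWithin_le_nhds h1, nhdsWithin_le_nhds h2] with w k1 k2 k3
        exact hgd w k2.le k3.le k1
      have hlim := Complex.tendsto_limUnder_of_differentiable_on_punctured_nhds_of_isLittleO
        hnhds ?_
      · refine ContinuousAt.continuousWithinAt ?_
        rw [continuousAt_iff_punctured_nhds]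
        have e : G (p i) = limUnder (𝓝[≠] (p i)) g := by
          simp only [hG]; rw [if_pos ⟨i, hi, rfl⟩]
        rw [e]
        refine hlim.congr' ?_
        filter_upwards [hGev (p i)] with w hw
        exact (hGg w hw).symm
      · rw [Asymptotics.isLittleO_iff_tendsto']
        · have h1 : Tendsto (fun z => (z - p i) * g (p i)) (𝓝[≠] (p i))
              (𝓝 ((p i - p i) * g (p i))) :=
            ((continuousAt_id.sub continuousAt_const).mul continuousAt_const).tendsto.mono_left
              nhdsWithin_le_nhds
          have h2 := (hmul i hi).sub h1
          simp only [sub_self, zero_mul] at h2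
          refine h2.congr fun z => ?_
          rw [div_inv_eq_mul]; ring
        · filter_upwards [self_mem_nhdsWithin] with w hw h
          exact absurd (inv_eq_zero.1 h) (sub_ne_zero.2 hw)
    · exact (hGd z hz.1 hz.2 hzS).continuousAt.continuousWithinAt
  have hP0 : ∀ ε > 0, ∃ T₀ : ℝ, ∀ z : ℂ, T₀ ≤ |z.im| → z ∉ S ∧ ‖P z‖ ≤ ε := by
    intro ε hε
    have hB : 0 ≤ ∑ i ∈ s, ‖R i‖ := Finset.sum_nonneg fun i _ => norm_nonneg _
    have hB' : 0 ≤ ∑ i ∈ s, |(p i).im| := Finset.sum_nonneg fun i _ => abs_nonneg _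
    refine ⟨∑ i ∈ s, |(p i).im| + ((∑ i ∈ s, ‖R i‖) / ε + 1), fun z hz => ?_⟩
    have hM : 0 < (∑ i ∈ s, ‖R i‖) / ε + 1 := by positivity
    have hlow : ∀ i ∈ s, (∑ i ∈ s, ‖R i‖) / ε + 1 ≤ ‖z - p i‖ := fun i hi => by
      have h1 : |(p i).im| ≤ ∑ i ∈ s, |(p i).im| :=
        Finset.single_le_sum (f := fun i => |(p i).im|) (fun i _ => abs_nonneg _) hi
      have h2 := Complex.abs_im_le_norm (z - p i)
      have h3 := abs_sub_abs_le_abs_sub z.im (p i).im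
      rw [Complex.sub_im] at h2
      linarith
    refine ⟨?_, ?_⟩
    · rintro ⟨i, hi, rfl⟩
      have := hlow i hi
      rw [sub_self, norm_zero] at this
      linarith
    · calc ‖P z‖ ≤ ∑ i ∈ s, ‖R i * (z - p i)⁻¹‖ := norm_sum_le _ _
        _ ≤ ∑ i ∈ s, ‖R i‖ * ((∑ i ∈ s, ‖R i‖) / ε + 1)⁻¹ := by
            refine Finset.sum_le_sum fun i hi => ?_
            rw [norm_mul, norm_inv]
            have := hlow i hi
            gcongr
        _ = (∑ i ∈ s, ‖R i‖) * ((∑ i ∈ s, ‖R i‖) / ε + 1)⁻¹ := by rw [Finset.sum_mul]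
        _ ≤ ε := by
            rw [← div_eq_mul_inv, div_le_iff₀ hM]
            field_simp
            linarith
  have hG0 : ∀ ε > 0, ∃ T₀ : ℝ, ∀ z : ℂ, a ≤ z.re → z.re ≤ b → T₀ ≤ |z.im| → ‖G z‖ ≤ ε := by
    intro ε hε
    obtain ⟨T₁, h1⟩ := h0 (ε / 2) (by positivity)
    obtain ⟨T₂, h2⟩ := hP0 (ε / 2) (by positivity)
    refine ⟨max T₁ T₂, fun z k1 k2 k3 => ?_⟩
    obtain ⟨hzS, hPz⟩ := h2 z ((le_max_right _ _).trans k3)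
    have := h1 z k1 k2 ((le_max_left _ _).trans k3)
    rw [hGg z hzS]
    refine (norm_sub_le _ _).trans ?_
    linarith
  have hlimG := tendsto_vertical_sub_of_continuousOn hab hSfin.countable hGc
    (fun z h1 h2 h3 => hGd z h1.le h2.le h3) hG0
  have hlimP : Tendsto (fun T : ℝ => ∑ i ∈ s, R i * ((∫ t in -T..T, ((b : ℂ) + t * I - p i)⁻¹) -
      ∫ t in -T..T, ((a : ℂ) + t * I - p i)⁻¹)) atTop (𝓝 (∑ i ∈ s, R i * (2 * π))) :=
    tendsto_finsetSum _ fun i hi =>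
      (tendsto_vertical_integral_inv_sub (hp i hi).1 (hp i hi).2).const_mul _
  have hsum := hlimG.add hlimP
  rw [zero_add, ← Finset.sum_mul, mul_comm] at hsum
  refine hsum.congr fun T => ?_
  have hline : ∀ x : ℝ, a ≤ x → x ≤ b → (∀ i ∈ s, (p i).re ≠ x) →
      ∫ t in -T..T, f (x + t * I) = (∫ t in -T..T, G (x + t * I)) +
        ∑ i ∈ s, R i * ∫ t in -T..T, ((x : ℂ) + t * I - p i)⁻¹ := by
    intro x h1 h2 hx
    have hxS : ∀ t : ℝ, (x : ℂ) + t * I ∉ S := by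
      rintro t ⟨i, hi, h⟩
      exact hx i hi (by simp [h])
    have hci : ∀ i ∈ s, Continuous fun t : ℝ => ((x : ℂ) + t * I - p i)⁻¹ := by
      intro i hi
      refine Continuous.inv₀ (by fun_prop) fun t h => hx i hi ?_
      have := congrArg Complex.re h
      simp at this
      linarith
    have hcG : Continuous fun t : ℝ => G (x + t * I) := by
      refine hGc.comp_continuous (by fun_prop) fun t => ?_
      simpa using ⟨h1, h2⟩
    simp_rw [← intervalIntegral.integral_const_mul]
    rw [← intervalIntegral.integral_finsetSum fun i hi =>
      ((hci i hi).const_mul _).intervalIntegrable _ _, ← intervalIntegral.integral_add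
      (hcG.intervalIntegrable _ _)]
    · refine intervalIntegral.integral_congr fun t _ => ?_
      simp only [hGg _ (hxS t), hg, hP]
      ring
    · exact (continuous_finsetSum _ fun i hi => (hci i hi).const_mul _).intervalIntegrable _ _
  rw [hline b hab le_rfl fun i hi => (hp i hi).2.ne, hline a le_rfl hab fun i hi => (hp i hi).1.ne']
  simp_rw [mul_sub]
  rw [Finset.sum_sub_distrib]
  ring

theorem norm_sin_le_exp_abs_im (w : ℂ) : ‖Complex.sin w‖ ≤ Real.exp |w.im| := by
  rw [Complex.sin, norm_div, norm_mul]
  simp only [norm_I, mul_one, RCLike.norm_ofNat]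
  have h : ‖Complex.exp (-w * I) - Complex.exp (w * I)‖ ≤
      Real.exp |w.im| + Real.exp |w.im| := by
    refine (norm_sub_le _ _).trans (add_le_add ?_ ?_) <;> rw [Complex.norm_exp] <;>
      apply Real.exp_le_exp.2
    · simpa using le_abs_self w.im
    · simpa using neg_le_abs w.im
  linarith

theorem exists_norm_Q_le (d K : ℕ) : ∃ C : ℝ, 0 ≤ C ∧ ∀ s : ℂ, -(K : ℝ) ≤ s.re → s.re ≤ 0 →
    1 ≤ |s.im| → ‖Q d s‖ ≤ C * |s.im| ^ (2 * s.re - 1) := by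
  obtain ⟨C, hC, h⟩ := exists_norm_Gamma_le (d + K + 1)
  refine ⟨C * C, by positivity, fun s h1 h2 h3 => ?_⟩
  set a : ℂ := ((d : ℂ) - 1) / 2 with ha
  have hare : a.re = ((d : ℝ) - 1) / 2 := by simp [ha]
  have haim : a.im = 0 := by simp [ha]
  have hd0 : (0 : ℝ) ≤ d := Nat.cast_nonneg d
  have hK0 : (0 : ℝ) ≤ K := Nat.cast_nonneg K
  have hpos : 0 < |s.im| := by linarith
  have hzne : ∀ z : ℂ, z.im ≠ 0 → Complex.Gamma z ≠ 0 := fun z hz =>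
    Complex.Gamma_ne_zero fun m hm => hz (by simp [hm])
  have him : s.im ≠ 0 := abs_pos.1 hpos
  have hQ : Q d s = Complex.Gamma (a + s) * Complex.Gamma (s - a) * Complex.sin (π * (s - a)) / π := by
    have e : ((d : ℂ) + 1) / 2 - s = 1 - (s - a) := by rw [ha]; ring
    have hr := Complex.Gamma_mul_Gamma_one_sub (s - a)
    have g1 : Complex.Gamma (s - a) ≠ 0 := hzne _ (by simpa [haim] using him)
    have g2 : Complex.Gamma (1 - (s - a)) ≠ 0 := hzne _ (by simpa [haim] using him)
    have hs : Complex.sin (π * (s - a)) ≠ 0 := fun h0 => by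
      rw [h0, div_zero] at hr
      exact mul_ne_zero g1 g2 hr
    have hpi : (π : ℂ) ≠ 0 := by exact_mod_cast Real.pi_ne_zero
    rw [Q, e, ← ha]
    rw [eq_div_iff hs] at hr
    generalize Complex.sin (π * (s - a)) = S at hr ⊢
    field_simp
    linear_combination (-Complex.Gamma (a + s)) * hr
  have g1 := h (a + s) (by simp [hare]; linarith) (by simp [hare]; linarith) (by simpa [haim] using h3)
  have g2 := h (s - a) (by simp [hare]; linarith) (by simp [hare]; linarith) (by simpa [haim] using h3)
  have g3 := norm_sin_le_exp_abs_im (π * (s - a))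
  simp only [add_re, add_im, sub_re, sub_im, haim, hare, zero_add, sub_zero] at g1 g2
  have e3 : |((π : ℂ) * (s - a)).im| = π * |s.im| := by
    simp [haim, abs_mul, abs_of_pos Real.pi_pos]
  rw [e3] at g3
  rw [hQ, norm_div, norm_mul, norm_mul]
  have e4 : ‖(π : ℂ)‖ = π := by simp [abs_of_pos Real.pi_pos]
  rw [e4, div_le_iff₀ Real.pi_pos]
  set E := Real.exp (-(π * |s.im| / 2)) with hE
  have eE : E * E * Real.exp (π * |s.im|) = 1 := by
    rw [hE, ← Real.exp_add, ← Real.exp_add]; ring_nf; simp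
  have eP : |s.im| ^ (((d : ℝ) - 1) / 2 + s.re - 1 / 2) * |s.im| ^ (s.re - ((d : ℝ) - 1) / 2 - 1 / 2) =
      |s.im| ^ (2 * s.re - 1) := by
    rw [← Real.rpow_add hpos]; ring_nf
  calc _ ≤ (C * (|s.im| ^ (((d : ℝ) - 1) / 2 + s.re - 1 / 2) * E)) *
        (C * (|s.im| ^ (s.re - ((d : ℝ) - 1) / 2 - 1 / 2) * E)) * Real.exp (π * |s.im|) := by gcongr
    _ = C * C * (|s.im| ^ (((d : ℝ) - 1) / 2 + s.re - 1 / 2) *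
        |s.im| ^ (s.re - ((d : ℝ) - 1) / 2 - 1 / 2)) * (E * E * Real.exp (π * |s.im|)) := by ring
    _ = C * C * |s.im| ^ (2 * s.re - 1) * 1 := by rw [eP, eE]
    _ ≤ _ := by gcongr; linarith [Real.pi_gt_three]

/-- The integrand of the Mellin-Barnes integral, as a function of `s`. -/
noncomputable def mellinBarnesIntegrand (d : ℕ) (r : ℂ) (Y ε : ℝ) (s : ℂ) : ℂ :=
  (Y : ℂ) ^ (1 - r - s) * Q d s * Complex.Gamma (s + 3 * r) *
    Complex.exp ((ε : ℂ) * (I * (π : ℂ) / 2) * (s + 3 * r))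

theorem exists_norm_mellinBarnesIntegrand_le (d K : ℕ) {r : ℂ} (hr0 : 0 < r.re)
    (hr1 : r.re < 1 / 6) {Y ε : ℝ} (hY : 0 < Y) (hε : |ε| = 1) :
    ∃ C T₀ : ℝ, 0 ≤ C ∧ 1 ≤ T₀ ∧ ∀ s : ℂ, -(K : ℝ) ≤ s.re → s.re ≤ 0 → T₀ ≤ |s.im| →
      ‖mellinBarnesIntegrand d r Y ε s‖ ≤ C * |s.im| ^ (3 * r.re - 3 / 2) := by
  obtain ⟨C₁, hC₁, h₁⟩ := exists_norm_Q_le d K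
  obtain ⟨C₂, hC₂, h₂⟩ := exists_norm_Gamma_le (K + 1)
  set B := Real.exp (|Real.log Y| * (2 + K)) with hB
  refine ⟨B * C₁ * (C₂ * 2), 2 + 6 * |r.im|, by positivity, by linarith [abs_nonneg r.im],
    fun s k1 k2 k3 => ?_⟩
  have hK0 : (0 : ℝ) ≤ K := Nat.cast_nonneg K
  have hri := abs_nonneg r.im
  have ht2 : 2 ≤ |s.im| := by linarith
  have hτ : |s.im| / 2 ≤ |s.im + 3 * r.im| := by
    have := abs_sub_abs_le_abs_sub s.im (-(3 * r.im))
    rw [abs_neg, abs_mul, sub_neg_eq_add, abs_of_pos (by norm_num : (0 : ℝ) < 3)] at this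
    linarith
  have hpos : 0 < |s.im| := by linarith
  have b1 : ‖(Y : ℂ) ^ (1 - r - s)‖ ≤ B := by
    rw [Complex.norm_cpow_eq_rpow_re_of_pos hY, Real.rpow_def_of_pos hY, hB]
    apply Real.exp_le_exp.2
    refine (le_abs_self _).trans ?_
    rw [abs_mul]
    gcongr
    rw [abs_le]
    simp
    constructor <;> linarith
  have b2 : ‖Q d s‖ ≤ C₁ * |s.im| ^ (-1 : ℝ) := by
    refine (h₁ s k1 k2 (by linarith)).trans ?_
    gcongr
    · linarith
    · linarith
  have b3 : ‖Complex.Gamma (s + 3 * r)‖ *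
      ‖Complex.exp ((ε : ℂ) * (I * (π : ℂ) / 2) * (s + 3 * r))‖ ≤
        C₂ * (2 * |s.im| ^ (3 * r.re - 1 / 2)) := by
    have hre : (s + 3 * r).re = s.re + 3 * r.re := by simp
    have him : (s + 3 * r).im = s.im + 3 * r.im := by simp
    have g := h₂ (s + 3 * r) (by rw [hre]; push_cast; linarith) (by rw [hre]; push_cast; linarith)
      (by rw [him]; linarith)
    rw [hre, him] at g
    have e : ‖Complex.exp ((ε : ℂ) * (I * (π : ℂ) / 2) * (s + 3 * r))‖ ≤
        Real.exp (π * |s.im + 3 * r.im| / 2) := by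
      rw [Complex.norm_exp]
      apply Real.exp_le_exp.2
      have : ((ε : ℂ) * (I * (π : ℂ) / 2) * (s + 3 * r)).re = -ε * (π / 2 * (s.im + 3 * r.im)) := by
        rw [show (ε : ℂ) * (I * (π : ℂ) / 2) * (s + 3 * r) =
          I * (((ε * (π / 2) : ℝ) : ℂ) * (s + 3 * r)) by push_cast; ring, Complex.I_mul_re,
          Complex.im_ofReal_mul, him]
        ring
      rw [this]
      refine (le_abs_self _).trans_eq ?_
      rw [abs_mul, abs_neg, hε, abs_mul, abs_of_pos (by positivity : 0 < π / 2)]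
      ring
    have hpow : |s.im + 3 * r.im| ^ (s.re + 3 * r.re - 1 / 2) ≤
        2 * |s.im| ^ (3 * r.re - 1 / 2) := by
      calc |s.im + 3 * r.im| ^ (s.re + 3 * r.re - 1 / 2)
          ≤ |s.im + 3 * r.im| ^ (3 * r.re - 1 / 2) :=
            Real.rpow_le_rpow_of_exponent_le (by linarith) (by linarith)
        _ ≤ (|s.im| / 2) ^ (3 * r.re - 1 / 2) :=
            Real.rpow_le_rpow_of_nonpos (by linarith) hτ (by linarith)
        _ = (1 / 2) ^ (3 * r.re - 1 / 2) * |s.im| ^ (3 * r.re - 1 / 2) := by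
            rw [← Real.mul_rpow (by norm_num) hpos.le]; ring_nf
        _ ≤ (1 / 2) ^ (-1 : ℝ) * |s.im| ^ (3 * r.re - 1 / 2) := by
            gcongr ?_ * _
            exact Real.rpow_le_rpow_of_exponent_ge (by norm_num) (by norm_num) (by linarith)
        _ = _ := by rw [Real.rpow_neg_one]; norm_num
    calc _ ≤ (C₂ * (|s.im + 3 * r.im| ^ (s.re + 3 * r.re - 1 / 2) *
          Real.exp (-(π * |s.im + 3 * r.im| / 2)))) * Real.exp (π * |s.im + 3 * r.im| / 2) := by
          gcongr
      _ = C₂ * |s.im + 3 * r.im| ^ (s.re + 3 * r.re - 1 / 2) *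
          (Real.exp (-(π * |s.im + 3 * r.im| / 2)) * Real.exp (π * |s.im + 3 * r.im| / 2)) := by ring
      _ = C₂ * |s.im + 3 * r.im| ^ (s.re + 3 * r.re - 1 / 2) := by
          rw [← Real.exp_add]; simp
      _ ≤ _ := by gcongr
  have ep : |s.im| ^ (-1 : ℝ) * |s.im| ^ (3 * r.re - 1 / 2) = |s.im| ^ (3 * r.re - 3 / 2) := by
    rw [← Real.rpow_add hpos]; ring_nf
  rw [mellinBarnesIntegrand, norm_mul, norm_mul, norm_mul, mul_assoc]
  calc _ ≤ B * (C₁ * |s.im| ^ (-1 : ℝ)) * (C₂ * (2 * |s.im| ^ (3 * r.re - 1 / 2))) := by gcongr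
    _ = B * C₁ * (C₂ * 2) * (|s.im| ^ (-1 : ℝ) * |s.im| ^ (3 * r.re - 1 / 2)) := by ring
    _ = _ := by rw [ep]

theorem differentiableAt_mellinBarnesIntegrand (d : ℕ) (r : ℂ) {Y : ℝ} (ε : ℝ) (hY : 0 < Y) {s : ℂ}
    (h1 : ∀ n : ℕ, s ≠ -3 * r - n) (h2 : ∀ n : ℕ, s ≠ -((d : ℂ) - 1) / 2 - n) :
    DifferentiableAt ℂ (mellinBarnesIntegrand d r Y ε) s := by
  have hYne : (Y : ℂ) ≠ 0 := by exact_mod_cast hY.ne'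
  have g1 : DifferentiableAt ℂ (fun s => Complex.Gamma (s + 3 * r)) s :=
    (Complex.differentiableAt_Gamma _ fun m hm => h1 m (by linear_combination hm)).comp s
      (by fun_prop : DifferentiableAt ℂ (fun s : ℂ => s + 3 * r) s)
  have g2 : DifferentiableAt ℂ (fun s => Complex.Gamma (((d : ℂ) - 1) / 2 + s)) s :=
    (Complex.differentiableAt_Gamma _ fun m hm => h2 m (by linear_combination hm)).comp s
      (by fun_prop : DifferentiableAt ℂ (fun s : ℂ => ((d : ℂ) - 1) / 2 + s) s)
  have g3 : DifferentiableAt ℂ (fun s => (Complex.Gamma (((d : ℂ) + 1) / 2 - s))⁻¹) s :=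
    (Complex.differentiable_one_div_Gamma _).comp s
      (by fun_prop : DifferentiableAt ℂ (fun s : ℂ => ((d : ℂ) + 1) / 2 - s) s)
  have g4 : DifferentiableAt ℂ (fun s => (Y : ℂ) ^ (1 - r - s)) s :=
    (by fun_prop : DifferentiableAt ℂ (fun s : ℂ => 1 - r - s) s).const_cpow (Or.inl hYne)
  have g5 : DifferentiableAt ℂ
      (fun s => Complex.exp ((ε : ℂ) * (I * (π : ℂ) / 2) * (s + 3 * r))) s := by fun_prop
  exact ((g4.mul (g2.mul g3)).mul g1).mul g5

open Filter Topology MeasureTheory in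
theorem integrable_vertical_mellinBarnesIntegrand (d K : ℕ) {r : ℂ} (hr0 : 0 < r.re)
    (hr1 : r.re < 1 / 6) {Y ε : ℝ} (hY : 0 < Y) (hε : |ε| = 1) {x : ℝ} (hx : -(K : ℝ) ≤ x)
    (hx0 : x ≤ 0) (h1 : ∀ n : ℕ, x ≠ -3 * r.re - n) (h2 : ∀ n : ℕ, x ≠ -((d : ℝ) - 1) / 2 - n) :
    Integrable fun t : ℝ => mellinBarnesIntegrand d r Y ε (x + t * I) := by
  obtain ⟨C, T₀, hC, hT, h⟩ := exists_norm_mellinBarnesIntegrand_le d K hr0 hr1 hY hε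
  have hcont : Continuous fun t : ℝ => mellinBarnesIntegrand d r Y ε (x + t * I) := by
    refine continuous_iff_continuousAt.2 fun t => ContinuousAt.comp
      (f := fun t : ℝ => (x : ℂ) + t * I) (g := mellinBarnesIntegrand d r Y ε)
      (differentiableAt_mellinBarnesIntegrand d r ε hY (fun n hn => h1 n ?_)
        fun n hn => h2 n ?_).continuousAt (by fun_prop)
    · simpa using congrArg Complex.re hn
    · simpa using congrArg Complex.re hn
  have hle : ∀ t : ℝ, T₀ ≤ |t| →
      ‖mellinBarnesIntegrand d r Y ε (x + t * I)‖ ≤ C * |t| ^ (3 * r.re - 3 / 2) := fun t ht => by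
    have := h (x + t * I) (by simpa using hx) (by simpa using hx0) (by simpa using ht)
    simpa using this
  have hint : IntegrableOn (fun t : ℝ => C * t ^ (3 * r.re - 3 / 2)) (Set.Ioi T₀) :=
    (integrableOn_Ioi_rpow_of_lt (by linarith) (by linarith)).const_mul C
  have i1 : IntegrableOn (fun t : ℝ => mellinBarnesIntegrand d r Y ε (x + t * I)) (Set.Ioi T₀) := by
    refine Integrable.mono' hint hcont.aestronglyMeasurable ?_
    filter_upwards [ae_restrict_mem measurableSet_Ioi] with t ht
    have ht' : T₀ < t := ht
    have := hle t (ht'.le.trans (le_abs_self t))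
    rwa [abs_of_pos (by linarith)] at this
  have i2 : IntegrableOn (fun t : ℝ => mellinBarnesIntegrand d r Y ε (x + t * I)) (Set.Iio (-T₀)) := by
    have i3 : IntegrableOn (fun t : ℝ => mellinBarnesIntegrand d r Y ε (x + (-t : ℝ) * I))
        (Set.Ioi T₀) := by
      refine Integrable.mono' hint (hcont.comp continuous_neg).aestronglyMeasurable ?_
      filter_upwards [ae_restrict_mem measurableSet_Ioi] with t ht
      have ht' : T₀ < t := ht
      have := hle (-t) (by rw [abs_neg]; exact ht'.le.trans (le_abs_self t))
      rwa [abs_neg, abs_of_pos (by linarith)] at this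
    have := i3.comp_neg
    simpa using this
  have i4 : IntegrableOn (fun t : ℝ => mellinBarnesIntegrand d r Y ε (x + t * I))
      (Set.Icc (-T₀) T₀) := hcont.integrableOn_Icc
  rw [← integrableOn_univ]
  refine ((i2.union i4).union i1).mono_set fun t _ => ?_
  rcases lt_or_ge t (-T₀) with k | k
  · exact Or.inl (Or.inl k)
  · rcases le_or_gt t T₀ with k' | k'
    · exact Or.inl (Or.inr ⟨k, k'⟩)
    · exact Or.inr k'

theorem one_div_le_abs_half_sub_add (d k : ℤ) : (1 : ℝ) / 12 ≤ |((d : ℝ) - 1) / 2 + 1 / 12 - k| := by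
  rcases le_or_gt (2 * k) (d - 1) with h | h
  · have : (2 : ℝ) * k ≤ d - 1 := by exact_mod_cast h
    exact le_trans (by linarith) (le_abs_self _)
  · have : (d : ℝ) - 1 + 1 ≤ 2 * k := by exact_mod_cast h
    exact le_trans (by linarith) (neg_le_abs _)

theorem norm_mellinBarnesIntegrand_sub_one (d : ℕ) (r : ℂ) {Y : ℝ} (ε : ℝ) (hY : 0 < Y) {s : ℂ}
    (h1 : ((d : ℂ) - 1) / 2 + (s - 1) ≠ 0) (h2 : ((d : ℂ) + 1) / 2 - s ≠ 0)
    (h3 : s - 1 + 3 * r ≠ 0) :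
    ‖mellinBarnesIntegrand d r Y ε (s - 1)‖ * (‖((d : ℂ) - 1) / 2 + (s - 1)‖ *
      ‖((d : ℂ) + 1) / 2 - s‖ * ‖s - 1 + 3 * r‖) = Y * ‖mellinBarnesIntegrand d r Y ε s‖ := by
  have hYne : (Y : ℂ) ≠ 0 := by exact_mod_cast hY.ne'
  have e1 : Complex.Gamma (((d : ℂ) - 1) / 2 + s) =
      (((d : ℂ) - 1) / 2 + (s - 1)) * Complex.Gamma (((d : ℂ) - 1) / 2 + (s - 1)) := by
    rw [← Complex.Gamma_add_one _ h1]; ring_nf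
  have e2 : Complex.Gamma (((d : ℂ) + 1) / 2 - (s - 1)) =
      (((d : ℂ) + 1) / 2 - s) * Complex.Gamma (((d : ℂ) + 1) / 2 - s) := by
    rw [← Complex.Gamma_add_one _ h2]; ring_nf
  have e3 : Complex.Gamma (s + 3 * r) = (s - 1 + 3 * r) * Complex.Gamma (s - 1 + 3 * r) := by
    rw [← Complex.Gamma_add_one _ h3]; ring_nf
  have e4 : (Y : ℂ) ^ (1 - r - (s - 1)) = (Y : ℂ) ^ (1 - r - s) * Y := by
    rw [show 1 - r - (s - 1) = (1 - r - s) + 1 by ring, Complex.cpow_add _ _ hYne, cpow_one]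
  have e5 : ‖Complex.exp ((ε : ℂ) * (I * (π : ℂ) / 2) * (s - 1 + 3 * r))‖ =
      ‖Complex.exp ((ε : ℂ) * (I * (π : ℂ) / 2) * (s + 3 * r))‖ := by
    rw [Complex.norm_exp, Complex.norm_exp]
    congr 1
    rw [show (ε : ℂ) * (I * (π : ℂ) / 2) * (s - 1 + 3 * r) =
      (ε : ℂ) * (I * (π : ℂ) / 2) * (s + 3 * r) + ((-(ε * π / 2) : ℝ) : ℂ) * I by push_cast; ring,
      Complex.add_re, Complex.re_ofReal_mul]
    simp
  have eY : ‖(Y : ℂ)‖ = Y := by simp [abs_of_pos hY]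
  simp only [mellinBarnesIntegrand, Q, e1, e2, e3, e4, norm_mul, norm_div, e5, eY]
  have := norm_ne_zero_iff.2 h2
  generalize ‖((d : ℂ) + 1) / 2 - s‖ = B at this ⊢
  rw [mul_comm B, ← div_div]
  generalize ‖Complex.Gamma (((d : ℂ) + 1) / 2 - s)‖ = G
  field_simp

theorem norm_mellinBarnesIntegrand_sub_natCast_le (d : ℕ) {r : ℂ} (hr0 : 0 < r.re)
    (hr1 : r.re < 1 / 6) {Y : ℝ} (ε : ℝ) (hY : 0 < Y) {s : ℂ} (hs : s.re = 1 / 12 - 1) (n : ℕ) :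
    ‖mellinBarnesIntegrand d r Y ε (s - n)‖ ≤
      (12 * Y) ^ n / n.factorial * ‖mellinBarnesIntegrand d r Y ε s‖ := by
  induction n with
  | zero => simp
  | succ n ih =>
    have hd0 : (0 : ℝ) ≤ d := Nat.cast_nonneg d
    have hn0 : (0 : ℝ) ≤ n := Nat.cast_nonneg n
    set z : ℂ := s - n with hz
    have hzre : z.re = 1 / 12 - 1 - n := by simp [hz, hs]
    have b1 : 1 / 12 ≤ ‖((d : ℂ) - 1) / 2 + (z - 1)‖ := by
      refine le_trans ?_ (Complex.abs_re_le_norm _)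
      have := one_div_le_abs_half_sub_add d (n + 2)
      refine this.trans_eq ?_
      congr 1
      simp [hzre]
      ring
    have b2 : (n + 1 : ℝ) ≤ ‖((d : ℂ) + 1) / 2 - z‖ := by
      refine le_trans ?_ (Complex.re_le_norm _)
      simp [hzre]
      linarith
    have b3 : 1 ≤ ‖z - 1 + 3 * r‖ := by
      refine le_trans (le_trans ?_ (neg_le_abs _)) (Complex.abs_re_le_norm _)
      simp [hzre]
      linarith
    have h := norm_mellinBarnesIntegrand_sub_one d r ε hY (s := z)
      (norm_pos_iff.1 (by linarith)) (norm_pos_iff.1 (by linarith)) (norm_pos_iff.1 (by linarith))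
    rw [show s - ((n + 1 : ℕ) : ℂ) = z - 1 by rw [hz]; push_cast; ring]
    have hle : (1 / 12 : ℝ) * (n + 1) * 1 ≤ ‖((d : ℂ) - 1) / 2 + (z - 1)‖ *
      ‖((d : ℂ) + 1) / 2 - z‖ * ‖z - 1 + 3 * r‖ := by gcongr
    have h5 : ‖mellinBarnesIntegrand d r Y ε (z - 1)‖ * ((1 / 12 : ℝ) * (n + 1)) ≤
        Y * ((12 * Y) ^ n / n.factorial * ‖mellinBarnesIntegrand d r Y ε s‖) := by
      calc _ ≤ ‖mellinBarnesIntegrand d r Y ε (z - 1)‖ * (‖((d : ℂ) - 1) / 2 + (z - 1)‖ *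
            ‖((d : ℂ) + 1) / 2 - z‖ * ‖z - 1 + 3 * r‖) := by
            rw [mul_one] at hle
            exact mul_le_mul_of_nonneg_left hle (norm_nonneg _)
        _ = _ := h
        _ ≤ _ := by gcongr
    rw [← le_div_iff₀ (by positivity)] at h5
    refine h5.trans_eq ?_
    rw [Nat.factorial_succ]
    push_cast
    field_simp
    ring

open Filter Topology in
theorem tendsto_add_natCast_mul_Gamma (n : ℕ) :
    Tendsto (fun z : ℂ => (z + n) * Complex.Gamma z) (𝓝[≠] (-n : ℂ))
      (𝓝 ((-1) ^ n / n.factorial)) := by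
  induction n with
  | zero => simpa using Complex.tendsto_self_mul_Gamma_nhds_zero
  | succ n ih =>
    have hne : -((n + 1 : ℕ) : ℂ) ≠ 0 := by
      rw [neg_ne_zero]; exact_mod_cast n.succ_ne_zero
    have h1 : Tendsto (fun z : ℂ => z + 1) (𝓝[≠] (-((n + 1 : ℕ) : ℂ))) (𝓝[≠] (-n : ℂ)) := by
      refine tendsto_nhdsWithin_iff.2 ⟨?_, ?_⟩
      · refine tendsto_nhdsWithin_of_tendsto_nhds ?_
        have : ContinuousAt (fun z : ℂ => z + 1) (-((n + 1 : ℕ) : ℂ)) := by fun_prop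
        convert this.tendsto using 2
        push_cast; ring
      · filter_upwards [self_mem_nhdsWithin] with z hz h
        apply hz
        have h' : z + 1 = -n := h
        simp only [Set.mem_singleton_iff]
        push_cast
        linear_combination h'
    have h2 : Tendsto (fun z : ℂ => z⁻¹) (𝓝[≠] (-((n + 1 : ℕ) : ℂ)))
        (𝓝 (-((n + 1 : ℕ) : ℂ))⁻¹) :=
      tendsto_nhdsWithin_of_tendsto_nhds (continuousAt_inv₀ hne).tendsto
    have h3 := (ih.comp h1).mul h2
    have e : (-1 : ℂ) ^ n / n.factorial * (-((n + 1 : ℕ) : ℂ))⁻¹ =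
        (-1) ^ (n + 1) / (n + 1).factorial := by
      rw [Nat.factorial_succ, inv_neg, pow_succ]
      push_cast
      field_simp
    rw [e] at h3
    refine h3.congr' ?_
    have : ∀ᶠ z : ℂ in 𝓝[≠] (-((n + 1 : ℕ) : ℂ)), z ≠ 0 :=
      nhdsWithin_le_nhds (isOpen_ne.mem_nhds hne)
    filter_upwards [this] with z hz
    simp only [Function.comp]
    rw [Complex.Gamma_add_one z hz]
    push_cast
    field_simp
    ring

open Filter Topology in
theorem tendsto_sub_mul_Gamma_add (a : ℂ) (n : ℕ) :
    Tendsto (fun z : ℂ => (z - (-a - n)) * Complex.Gamma (z + a)) (𝓝[≠] (-a - n))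
      (𝓝 ((-1) ^ n / n.factorial)) := by
  have h1 : Tendsto (fun z : ℂ => z + a) (𝓝[≠] (-a - n)) (𝓝[≠] (-n : ℂ)) := by
    refine tendsto_nhdsWithin_iff.2 ⟨tendsto_nhdsWithin_of_tendsto_nhds ?_, ?_⟩
    · have : ContinuousAt (fun z : ℂ => z + a) (-a - n) := by fun_prop
      convert this.tendsto using 2
      ring
    · filter_upwards [self_mem_nhdsWithin] with z hz h
      have h' : z + a = -n := h
      exact hz (by simp only [Set.mem_singleton_iff]; linear_combination h')
  refine ((tendsto_add_natCast_mul_Gamma n).comp h1).congr fun z => ?_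
  simp only [Function.comp]
  ring_nf

/-- The residue of the integrand at `s = -3r - n`. -/
noncomputable def residueA (d : ℕ) (r : ℂ) (Y ε : ℝ) (n : ℕ) : ℂ :=
  (-1) ^ n / n.factorial * ((Y : ℂ) ^ (1 + 2 * r + n) * Q d (-3 * r - n) *
    Complex.exp ((ε : ℂ) * (I * (π : ℂ) / 2) * (-n)))

/-- The residue of the integrand at `s = -(d-1)/2 - n`. -/
noncomputable def residueB (d : ℕ) (r : ℂ) (Y ε : ℝ) (n : ℕ) : ℂ :=
  (-1) ^ n / n.factorial * ((Y : ℂ) ^ (1 - r + ((d : ℂ) - 1) / 2 + n) *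
    (Complex.Gamma (d + n))⁻¹ * Complex.Gamma (3 * r - ((d : ℂ) - 1) / 2 - n) *
    Complex.exp ((ε : ℂ) * (I * (π : ℂ) / 2) * (3 * r - ((d : ℂ) - 1) / 2 - n)))

open Filter Topology in
theorem tendsto_residueA (d : ℕ) (r : ℂ) {Y : ℝ} (ε : ℝ) (hY : 0 < Y) (n : ℕ)
    (h : ∀ m : ℕ, -3 * r - n ≠ -((d : ℂ) - 1) / 2 - m) :
    Tendsto (fun z => (z - (-3 * r - n)) * mellinBarnesIntegrand d r Y ε z) (𝓝[≠] (-3 * r - n))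
      (𝓝 (residueA d r Y ε n)) := by
  have hYne : (Y : ℂ) ≠ 0 := by exact_mod_cast hY.ne'
  set s : ℂ := -3 * r - n with hs
  have g2 : DifferentiableAt ℂ (fun s => Complex.Gamma (((d : ℂ) - 1) / 2 + s)) s :=
    (Complex.differentiableAt_Gamma _ fun m hm => h m (by linear_combination hm)).comp s
      (by fun_prop : DifferentiableAt ℂ (fun s : ℂ => ((d : ℂ) - 1) / 2 + s) s)
  have g3 : DifferentiableAt ℂ (fun s => (Complex.Gamma (((d : ℂ) + 1) / 2 - s))⁻¹) s :=
    (Complex.differentiable_one_div_Gamma _).comp s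
      (by fun_prop : DifferentiableAt ℂ (fun s : ℂ => ((d : ℂ) + 1) / 2 - s) s)
  have g4 : DifferentiableAt ℂ (fun s => (Y : ℂ) ^ (1 - r - s)) s :=
    (by fun_prop : DifferentiableAt ℂ (fun s : ℂ => 1 - r - s) s).const_cpow (Or.inl hYne)
  have g5 : DifferentiableAt ℂ
      (fun s => Complex.exp ((ε : ℂ) * (I * (π : ℂ) / 2) * (s + 3 * r))) s := by fun_prop
  have g := ((g4.mul (g2.mul g3)).mul g5).continuousAt.tendsto.mono_left
    (nhdsWithin_le_nhds (s := {s}ᶜ))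
  have h1 := tendsto_sub_mul_Gamma_add (3 * r) n
  rw [show -(3 * r) - (n : ℂ) = s by rw [hs]; ring] at h1
  have h2 := h1.mul g
  have e : residueA d r Y ε n = (-1) ^ n / n.factorial *
      ((Y : ℂ) ^ (1 - r - s) * (Complex.Gamma (((d : ℂ) - 1) / 2 + s) *
        (Complex.Gamma (((d : ℂ) + 1) / 2 - s))⁻¹) *
        Complex.exp ((ε : ℂ) * (I * (π : ℂ) / 2) * (s + 3 * r))) := by
    rw [residueA, Q, ← hs, show s + 3 * r = -n by rw [hs]; ring,
      show 1 - r - s = 1 + 2 * r + n by rw [hs]; ring, div_eq_mul_inv (Complex.Gamma _)]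
  rw [e]
  refine h2.congr fun z => ?_
  simp only [mellinBarnesIntegrand, Q, Pi.mul_apply]
  ring

open Filter Topology in
theorem tendsto_residueB (d : ℕ) (r : ℂ) {Y : ℝ} (ε : ℝ) (hY : 0 < Y) (n : ℕ)
    (h : ∀ m : ℕ, -((d : ℂ) - 1) / 2 - n ≠ -3 * r - m) :
    Tendsto (fun z => (z - (-((d : ℂ) - 1) / 2 - n)) * mellinBarnesIntegrand d r Y ε z)
      (𝓝[≠] (-((d : ℂ) - 1) / 2 - n)) (𝓝 (residueB d r Y ε n)) := by
  have hYne : (Y : ℂ) ≠ 0 := by exact_mod_cast hY.ne'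
  set s : ℂ := -((d : ℂ) - 1) / 2 - n with hs
  have g2 : DifferentiableAt ℂ (fun s => Complex.Gamma (s + 3 * r)) s :=
    (Complex.differentiableAt_Gamma _ fun m hm => h m (by linear_combination hm)).comp s
      (by fun_prop : DifferentiableAt ℂ (fun s : ℂ => s + 3 * r) s)
  have g3 : DifferentiableAt ℂ (fun s => (Complex.Gamma (((d : ℂ) + 1) / 2 - s))⁻¹) s :=
    (Complex.differentiable_one_div_Gamma _).comp s
      (by fun_prop : DifferentiableAt ℂ (fun s : ℂ => ((d : ℂ) + 1) / 2 - s) s)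
  have g4 : DifferentiableAt ℂ (fun s => (Y : ℂ) ^ (1 - r - s)) s :=
    (by fun_prop : DifferentiableAt ℂ (fun s : ℂ => 1 - r - s) s).const_cpow (Or.inl hYne)
  have g5 : DifferentiableAt ℂ
      (fun s => Complex.exp ((ε : ℂ) * (I * (π : ℂ) / 2) * (s + 3 * r))) s := by fun_prop
  have g := (((g4.mul g3).mul g2).mul g5).continuousAt.tendsto.mono_left
    (nhdsWithin_le_nhds (s := {s}ᶜ))
  have h1 := tendsto_sub_mul_Gamma_add (((d : ℂ) - 1) / 2) n
  rw [show -(((d : ℂ) - 1) / 2) - (n : ℂ) = s by rw [hs]; ring] at h1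
  have h2 := h1.mul g
  have e : residueB d r Y ε n = (-1) ^ n / n.factorial *
      ((Y : ℂ) ^ (1 - r - s) * (Complex.Gamma (((d : ℂ) + 1) / 2 - s))⁻¹ *
        Complex.Gamma (s + 3 * r) *
        Complex.exp ((ε : ℂ) * (I * (π : ℂ) / 2) * (s + 3 * r))) := by
    rw [residueB, show s + 3 * r = 3 * r - ((d : ℂ) - 1) / 2 - n by rw [hs]; ring,
      show 1 - r - s = 1 - r + ((d : ℂ) - 1) / 2 + n by rw [hs]; ring,
      show ((d : ℂ) + 1) / 2 - s = d + n by rw [hs]; ring]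
  rw [e]
  refine h2.congr fun z => ?_
  simp only [mellinBarnesIntegrand, Q, Pi.mul_apply, div_eq_mul_inv (Complex.Gamma _), add_comm z]
  ring

theorem intCast_ne_of_mem_Ioo {x : ℝ} (h0 : 0 < x) (h1 : x < 1) (k : ℤ) : (k : ℝ) ≠ x := by
  rintro rfl
  have h0' : 0 < k := by exact_mod_cast h0
  have h1' : k < 1 := by exact_mod_cast h1
  omega

theorem neg_three_mul_sub_ne (d : ℕ) {r : ℂ} (hr0 : 0 < r.re) (hr1 : r.re < 1 / 6) (n m : ℕ) :
    -3 * r - n ≠ -((d : ℂ) - 1) / 2 - m := fun h => by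
  have h' := congrArg Complex.re h
  refine intCast_ne_of_mem_Ioo (x := 6 * r.re) (by linarith) (by linarith)
    ((d : ℤ) - 1 + 2 * m - 2 * n) ?_
  simp at h'
  push_cast
  linarith

open Filter Topology MeasureTheory in
theorem integral_vertical_sub_eq_sum_residues (d : ℕ) (hd : 2 ≤ d) {r : ℂ} (hr0 : 0 < r.re)
    (hr1 : r.re < 1 / 6) {Y ε : ℝ} (hY : 0 < Y) (hε : |ε| = 1) (j : ℕ) :
    (∫ t : ℝ, mellinBarnesIntegrand d r Y ε ((0 : ℝ) + t * I)) -
      (∫ t : ℝ, mellinBarnesIntegrand d r Y ε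
        ((1 / 12 - 1 - ((j + (d - 1) / 2 : ℕ) : ℝ) : ℝ) + t * I)) =
      2 * π * ((∑ n ∈ Finset.range (j + 1 + (d - 1) / 2), residueA d r Y ε n) +
        ∑ n ∈ Finset.range (j + 1), residueB d r Y ε n) := by
  set m := (d - 1) / 2 with hm
  have hm1 : 2 * m + 1 ≤ d := by omega
  have hm2 : d ≤ 2 * m + 2 := by omega
  have hm1' : 2 * (m : ℝ) + 1 ≤ d := by exact_mod_cast hm1
  have hm2' : (d : ℝ) ≤ 2 * m + 2 := by exact_mod_cast hm2
  have hd' : (2 : ℝ) ≤ d := by exact_mod_cast hd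
  have hj0 : (0 : ℝ) ≤ j := Nat.cast_nonneg j
  have hm0 : (0 : ℝ) ≤ m := Nat.cast_nonneg m
  set x : ℝ := 1 / 12 - 1 - ((j + m : ℕ) : ℝ) with hx
  have hx' : x = 1 / 12 - 1 - (j + m) := by rw [hx]; push_cast; ring
  set p : ℕ ⊕ ℕ → ℂ := Sum.elim (fun n => -3 * r - n) (fun n => -((d : ℂ) - 1) / 2 - n) with hp
  have hpA : ∀ n : ℕ, (-3 * r - n : ℂ).re = -3 * r.re - n := fun n => by simp
  have hpB : ∀ n : ℕ, (-((d : ℂ) - 1) / 2 - n : ℂ).re = -((d : ℝ) - 1) / 2 - n := fun n => by simp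
  have hint0 : Integrable fun t : ℝ => mellinBarnesIntegrand d r Y ε ((0 : ℝ) + t * I) := by
    refine integrable_vertical_mellinBarnesIntegrand d 0 hr0 hr1 hY hε (by simp) le_rfl
      (fun n hn => ?_) fun n hn => ?_
    · have : (0 : ℝ) ≤ n := Nat.cast_nonneg n
      linarith
    · have : (0 : ℝ) ≤ n := Nat.cast_nonneg n
      linarith
  have hintx : Integrable fun t : ℝ => mellinBarnesIntegrand d r Y ε (x + t * I) := by
    refine integrable_vertical_mellinBarnesIntegrand d (j + m + 1) hr0 hr1 hY hε ?_ ?_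
      (fun n hn => ?_) fun n hn => ?_
    · rw [hx']; push_cast; linarith
    · rw [hx']; linarith
    · refine intCast_ne_of_mem_Ioo (x := 3 * r.re + 1 / 12) (by linarith) (by linarith)
        (1 + j + m - n) ?_
      rw [hx'] at hn
      push_cast
      linarith
    · refine intCast_ne_of_mem_Ioo (x := 1 / 6) (by norm_num) (by norm_num)
        (2 + 2 * j + 2 * m - 2 * n - (d - 1)) ?_
      rw [hx'] at hn
      push_cast
      linarith
  obtain ⟨C, T₀, hC, hT, hle⟩ :=
    exists_norm_mellinBarnesIntegrand_le d (j + m + 1) hr0 hr1 hY hε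
  have key := tendsto_vertical_sub_of_simple_poles (a := x) (b := 0) (by rw [hx']; linarith)
    (f := mellinBarnesIntegrand d r Y ε)
    ((Finset.range (j + 1 + m)).disjSum (Finset.range (j + 1))) p
    (Sum.elim (residueA d r Y ε) (residueB d r Y ε)) ?_ ?_ ?_ ?_ ?_
  · rw [Finset.sum_disjSum] at key
    refine tendsto_nhds_unique ?_ key
    exact (intervalIntegral_tendsto_integral hint0 tendsto_neg_atTop_atBot tendsto_id).sub
      (intervalIntegral_tendsto_integral hintx tendsto_neg_atTop_atBot tendsto_id)
  · rintro (n | n) - (k | k) - h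
    · simpa [hp] using h
    · exact absurd h (neg_three_mul_sub_ne d hr0 hr1 n k)
    · exact absurd h.symm (neg_three_mul_sub_ne d hr0 hr1 k n)
    · simpa [hp] using h
  · rintro (n | n) hn
    · have hn' : n ≤ j + m := by
        have := Finset.inl_mem_disjSum.1 hn
        rw [Finset.mem_range] at this
        omega
      have hn2 : (n : ℝ) ≤ j + m := by exact_mod_cast hn'
      have hn0 : (0 : ℝ) ≤ n := Nat.cast_nonneg n
      rw [hp, Sum.elim_inl, hpA, hx']
      constructor <;> linarith
    · have hn' : n ≤ j := by
        have := Finset.inr_mem_disjSum.1 hn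
        rw [Finset.mem_range] at this
        omega
      have hn2 : (n : ℝ) ≤ j := by exact_mod_cast hn'
      have hn0 : (0 : ℝ) ≤ n := Nat.cast_nonneg n
      rw [hp, Sum.elim_inr, hpB, hx']
      constructor <;> linarith
  · intro z hz _ hne
    refine differentiableAt_mellinBarnesIntegrand d r ε hY (fun n hn => ?_) fun n hn => ?_
    · by_cases hnr : n < j + 1 + m
      · exact hne (Sum.inl n) (Finset.inl_mem_disjSum.2 (Finset.mem_range.2 hnr)) hn
      · have h1 : (j + 1 + m : ℝ) ≤ n := by exact_mod_cast not_lt.1 hnr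
        rw [hn, hpA, hx'] at hz
        linarith
    · by_cases hnr : n < j + 1
      · exact hne (Sum.inr n) (Finset.inr_mem_disjSum.2 (Finset.mem_range.2 hnr)) hn
      · have h1 : (j + 1 : ℝ) ≤ n := by exact_mod_cast not_lt.1 hnr
        rw [hn, hpB, hx'] at hz
        linarith
  · rintro (n | n) -
    · exact tendsto_residueA d r ε hY n (neg_three_mul_sub_ne d hr0 hr1 n)
    · exact tendsto_residueB d r ε hY n fun k => (neg_three_mul_sub_ne d hr0 hr1 k n).symm
  · intro δ hδ
    have hlim : Tendsto (fun t : ℝ => C * t ^ (-(3 / 2 - 3 * r.re))) atTop (𝓝 (C * 0)) :=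
      (tendsto_rpow_neg_atTop (by linarith)).const_mul C
    rw [mul_zero] at hlim
    obtain ⟨T₁, hT₁⟩ := eventually_atTop.1 (hlim.eventually (gt_mem_nhds hδ))
    refine ⟨max T₀ T₁, fun z h1 h2 h3 => ?_⟩
    refine (hle z ?_ h2 ((le_max_left _ _).trans h3)).trans ?_
    · rw [hx'] at h1; push_cast; linarith
    · have := hT₁ _ ((le_max_right _ _).trans h3)
      rw [neg_sub] at this
      exact this.le

open Filter Topology MeasureTheory in
theorem tendsto_sum_residues (d : ℕ) (hd : 2 ≤ d) {r : ℂ} (hr0 : 0 < r.re)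
    (hr1 : r.re < 1 / 6) {Y ε : ℝ} (hY : 0 < Y) (hε : |ε| = 1) :
    Tendsto (fun j : ℕ => 2 * π * ((∑ n ∈ Finset.range (j + 1 + (d - 1) / 2), residueA d r Y ε n) +
        ∑ n ∈ Finset.range (j + 1), residueB d r Y ε n)) atTop
      (𝓝 (∫ t : ℝ, mellinBarnesIntegrand d r Y ε ((0 : ℝ) + t * I))) := by
  set m := (d - 1) / 2 with hm
  set x : ℝ := 1 / 12 - 1 with hx
  have hint : Integrable fun t : ℝ => mellinBarnesIntegrand d r Y ε (x + t * I) := by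
    refine integrable_vertical_mellinBarnesIntegrand d 1 hr0 hr1 hY hε ?_ ?_
      (fun n hn => ?_) fun n hn => ?_
    · rw [hx]; norm_num
    · rw [hx]; norm_num
    · refine intCast_ne_of_mem_Ioo (x := 3 * r.re + 1 / 12) (by linarith) (by linarith) (1 - n) ?_
      rw [hx] at hn
      push_cast
      linarith
    · refine intCast_ne_of_mem_Ioo (x := 1 / 6) (by norm_num) (by norm_num)
        (2 - 2 * n - (d - 1)) ?_
      push_cast
      linarith
  set A := ∫ t : ℝ, ‖mellinBarnesIntegrand d r Y ε (x + t * I)‖ with hA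
  have hbound : ∀ n : ℕ, ‖∫ t : ℝ, mellinBarnesIntegrand d r Y ε ((x - (n : ℝ) : ℝ) + t * I)‖ ≤
      (12 * Y) ^ n / n.factorial * A := fun n => by
    rw [hA, ← integral_const_mul]
    refine norm_integral_le_of_norm_le (hint.norm.const_mul _) (ae_of_all _ fun t => ?_)
    have := norm_mellinBarnesIntegrand_sub_natCast_le d hr0 hr1 ε hY (s := x + t * I)
      (by simp [hx]) n
    rwa [show (x : ℂ) + t * I - n = ((x - (n : ℝ) : ℝ) : ℂ) + t * I by push_cast; ring] at this
  have hlim : Tendsto (fun j : ℕ => ∫ t : ℝ,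
      mellinBarnesIntegrand d r Y ε ((x - ((j + m : ℕ) : ℝ) : ℝ) + t * I)) atTop (𝓝 0) := by
    refine squeeze_zero_norm (fun j => hbound (j + m)) ?_
    have h := ((FloorSemiring.tendsto_pow_div_factorial_atTop (12 * Y)).comp
      (tendsto_add_atTop_nat m)).mul_const A
    rw [zero_mul] at h
    exact h
  have h2 := (tendsto_const_nhds (x := ∫ t : ℝ,
    mellinBarnesIntegrand d r Y ε ((0 : ℝ) + t * I))).sub hlim
  rw [sub_zero] at h2
  exact h2.congr fun j => integral_vertical_sub_eq_sum_residues d hd hr0 hr1 hY hε j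

open Filter Topology in
theorem summable_Jw4_term (x a₁ a₂ a₃ : ℂ) :
    Summable fun n : ℕ => x ^ n * ((n.factorial : ℂ) * Complex.Gamma ((n : ℂ) + 1 + a₁ - a₃) *
      Complex.Gamma ((n : ℂ) + 1 + a₂ - a₃))⁻¹ := by
  refine summable_of_ratio_norm_eventually_le (r := 1 / 2) (by norm_num) ?_
  filter_upwards [eventually_ge_atTop (⌈2 * ‖x‖⌉₊), eventually_ge_atTop (⌈‖a₁ - a₃‖⌉₊),
    eventually_ge_atTop (⌈‖a₂ - a₃‖⌉₊)] with n h0 h1 h2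
  have hge : ∀ b : ℂ, ‖b‖ ≤ n → 1 ≤ ‖(n : ℂ) + 1 + b‖ := fun b hb => by
    have e1 : ‖((n : ℂ) + 1 + b) - b‖ = n + 1 := by
      rw [add_sub_cancel_right]
      exact_mod_cast Complex.norm_natCast (n + 1)
    have := norm_sub_le ((n : ℂ) + 1 + b) b
    linarith
  have g1 := hge _ (Nat.ceil_le.1 h1)
  have g2 := hge _ (Nat.ceil_le.1 h2)
  have g0 := Nat.ceil_le.1 h0
  rw [← add_sub_assoc] at g1 g2
  have e : ∀ b : ℂ, 1 ≤ ‖(n : ℂ) + 1 + b - a₃‖ →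
      Complex.Gamma (((n + 1 : ℕ) : ℂ) + 1 + b - a₃) =
        ((n : ℂ) + 1 + b - a₃) * Complex.Gamma ((n : ℂ) + 1 + b - a₃) := fun b hb => by
    rw [← Complex.Gamma_add_one _ (norm_pos_iff.1 (by linarith))]
    push_cast
    ring_nf
  rw [e _ g1, e _ g2, Nat.factorial_succ, pow_succ]
  simp only [norm_mul, norm_inv, norm_pow, Nat.cast_mul, Complex.norm_natCast]
  set P := ‖(n : ℂ) + 1 + a₁ - a₃‖
  set R := ‖(n : ℂ) + 1 + a₂ - a₃‖
  set G := ‖Complex.Gamma ((n : ℂ) + 1 + a₁ - a₃)‖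
  set H := ‖Complex.Gamma ((n : ℂ) + 1 + a₂ - a₃)‖
  have hn0 : (0 : ℝ) ≤ n := Nat.cast_nonneg n
  have hfac : ‖x‖ * (((n + 1 : ℕ) : ℝ) * P * R)⁻¹ ≤ 1 / 2 := by
    rw [← div_eq_mul_inv, div_le_iff₀ (by positivity)]
    have : ((n : ℝ) + 1) * 1 * 1 ≤ ((n + 1 : ℕ) : ℝ) * P * R := by push_cast; gcongr
    linarith
  calc _ = (‖x‖ * (((n + 1 : ℕ) : ℝ) * P * R)⁻¹) * (‖x‖ ^ n * (n.factorial * G * H)⁻¹) := by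
        simp only [mul_inv]; ring
    _ ≤ _ := by gcongr

theorem Gamma_sub_natCast {z : ℂ} (hz : Complex.sin (π * z) ≠ 0) (n : ℕ) :
    Complex.Gamma (z - n) =
      (-1) ^ n * (π / Complex.sin (π * z)) * (Complex.Gamma (n + 1 - z))⁻¹ := by
  have h := Complex.Gamma_mul_Gamma_one_sub (z - n)
  have e : Complex.sin (π * (z - n)) = (-1) ^ n * Complex.sin (π * z) := by
    rw [show (π : ℂ) * (z - n) = π * z - n * π by ring, Complex.sin_antiperiodic.sub_nat_mul_eq]
  have hne : Complex.Gamma (n + 1 - z) ≠ 0 := by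
    refine Complex.Gamma_ne_zero fun m hm => hz ?_
    rw [show z = ((n + 1 + m : ℕ) : ℂ) by push_cast; linear_combination -hm, mul_comm]
    exact Complex.sin_nat_mul_pi _
  rw [show (1 : ℂ) - (z - n) = n + 1 - z by ring, e] at h
  have h1 : ((-1 : ℂ) ^ n)⁻¹ = (-1) ^ n := by rw [← inv_pow]; norm_num
  rw [eq_mul_inv_iff_mul_eq₀ hne, h, div_mul_eq_div_div_swap, div_eq_mul_inv _ ((-1 : ℂ) ^ n), h1,
    mul_comm]

theorem exp_mul_neg_natCast {ε : ℝ} (hε : ε = 1 ∨ ε = -1) (n : ℕ) :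
    Complex.exp ((ε : ℂ) * (I * (π : ℂ) / 2) * (-n)) = (-(I * ε)) ^ n := by
  rw [show (ε : ℂ) * (I * (π : ℂ) / 2) * (-n) = n * (-((ε : ℂ) * (π / 2 * I))) by ring,
    Complex.exp_nat_mul]
  rcases hε with rfl | rfl
  · rw [Complex.exp_neg]; simp [Complex.exp_pi_div_two_mul_I]
  · simp [Complex.exp_pi_div_two_mul_I]

theorem residueA_eq (d : ℕ) {r : ℂ} {Y ε : ℝ} (hY : 0 < Y) (hε : ε = 1 ∨ ε = -1)
    (hs : Complex.sin (π * (((d : ℂ) - 1) / 2 - 3 * r)) ≠ 0) (n : ℕ) :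
    residueA d r Y ε n = π / Complex.sin (π * (((d : ℂ) - 1) / 2 - 3 * r)) *
      ((Y : ℂ) ^ (1 - (-2 * r)) * ((-(I * ε) * Y) ^ n * ((n.factorial : ℂ) *
        Complex.Gamma ((n : ℂ) + 1 + (((d : ℂ) - 1) / 2 + r) - (-2 * r)) *
        Complex.Gamma ((n : ℂ) + 1 + (-((d : ℂ) - 1) / 2 + r) - (-2 * r)))⁻¹)) := by
  have hYne : (Y : ℂ) ≠ 0 := by exact_mod_cast hY.ne'
  rw [residueA, Q, show ((d : ℂ) - 1) / 2 + (-3 * r - n) = ((d : ℂ) - 1) / 2 - 3 * r - n by ring,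
    Gamma_sub_natCast hs, exp_mul_neg_natCast hε, Complex.cpow_add _ _ hYne, Complex.cpow_natCast,
    show ((d : ℂ) + 1) / 2 - (-3 * r - n) = (n : ℂ) + 1 + (((d : ℂ) - 1) / 2 + r) - (-2 * r) by ring,
    show (n : ℂ) + 1 - (((d : ℂ) - 1) / 2 - 3 * r) =
      (n : ℂ) + 1 + (-((d : ℂ) - 1) / 2 + r) - (-2 * r) by ring,
    show 1 + 2 * r = 1 - (-2 * r) by ring, mul_pow, mul_inv, mul_inv]
  have h1 : (-1 : ℂ) ^ n * (-1) ^ n = 1 := by rw [← mul_pow]; norm_num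
  simp only [div_eq_mul_inv]
  generalize (-1 : ℂ) ^ n = u at h1 ⊢
  generalize (Complex.sin _)⁻¹ = S
  generalize (Complex.Gamma ((n : ℂ) + 1 + (((d : ℂ) - 1) * 2⁻¹ + r) - _))⁻¹ = G
  generalize (Complex.Gamma _)⁻¹ = H
  linear_combination ((n.factorial : ℂ)⁻¹ * (Y : ℂ) ^ (1 - (-2 * r)) * Y ^ n * π * S * H * G *
    (-(I * ε)) ^ n) * h1

theorem residueB_eq (d : ℕ) {r : ℂ} {Y ε : ℝ} (hY : 0 < Y) (hε : ε = 1 ∨ ε = -1)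
    (hs : Complex.sin (π * (3 * r - ((d : ℂ) - 1) / 2)) ≠ 0) (n : ℕ) :
    residueB d r Y ε n = π / Complex.sin (π * (3 * r - ((d : ℂ) - 1) / 2)) *
      Complex.exp (-((ε : ℂ) * I * (π : ℂ) / 2) * (((d : ℂ) - 1) / 2 - 3 * r)) *
      ((Y : ℂ) ^ (1 - (-((d : ℂ) - 1) / 2 + r)) * ((-(I * ε) * Y) ^ n * ((n.factorial : ℂ) *
        Complex.Gamma ((n : ℂ) + 1 + (-2 * r) - (-((d : ℂ) - 1) / 2 + r)) *
        Complex.Gamma ((n : ℂ) + 1 + (((d : ℂ) - 1) / 2 + r) - (-((d : ℂ) - 1) / 2 + r)))⁻¹)) := by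
  have hYne : (Y : ℂ) ≠ 0 := by exact_mod_cast hY.ne'
  rw [residueB, Gamma_sub_natCast hs,
    show (ε : ℂ) * (I * (π : ℂ) / 2) * (3 * r - ((d : ℂ) - 1) / 2 - n) =
      -((ε : ℂ) * I * (π : ℂ) / 2) * (((d : ℂ) - 1) / 2 - 3 * r) +
      (ε : ℂ) * (I * (π : ℂ) / 2) * (-n) by ring, Complex.exp_add,
    exp_mul_neg_natCast hε, Complex.cpow_add _ _ hYne, Complex.cpow_natCast,
    show (d : ℂ) + n = (n : ℂ) + 1 + (((d : ℂ) - 1) / 2 + r) - (-((d : ℂ) - 1) / 2 + r) by ring,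
    show (n : ℂ) + 1 - (3 * r - ((d : ℂ) - 1) / 2) =
      (n : ℂ) + 1 + (-2 * r) - (-((d : ℂ) - 1) / 2 + r) by ring,
    show 1 - r + ((d : ℂ) - 1) / 2 = 1 - (-((d : ℂ) - 1) / 2 + r) by ring, mul_pow, mul_inv, mul_inv]
  have h1 : (-1 : ℂ) ^ n * (-1) ^ n = 1 := by rw [← mul_pow]; norm_num
  generalize (-1 : ℂ) ^ n = u at h1 ⊢
  generalize Complex.exp _ = E
  generalize (Complex.Gamma ((n : ℂ) + 1 + (-2 * r) - _))⁻¹ = G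
  generalize (Complex.Gamma _)⁻¹ = H
  simp only [div_eq_mul_inv]
  generalize (Complex.sin _)⁻¹ = S
  generalize (Y : ℂ) ^ (_ : ℂ) = Z
  linear_combination ((n.factorial : ℂ)⁻¹ * Z * Y ^ n * π * S * H * G * E * (-(I * ε)) ^ n) * h1

open Filter Topology in
theorem integral_mellinBarnesIntegrand_eq (d : ℕ) (hd : 2 ≤ d) {r : ℂ} (hr0 : 0 < r.re)
    (hr1 : r.re < 1 / 6) {y₁ : ℝ} (hy : y₁ ≠ 0)
    (hs : Complex.sin (π * (3 * r - ((d : ℂ) - 1) / 2)) ≠ 0) :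
    ∫ t : ℝ, mellinBarnesIntegrand d r |8 * Real.pi ^ 3 * y₁| (Real.sign y₁) ((0 : ℝ) + t * I) =
      2 * π * (π / Complex.sin (π * (3 * r - ((d : ℂ) - 1) / 2)) *
        (Jw4 y₁ (-2 * r) (((d : ℂ) - 1) / 2 + r) (-((d : ℂ) - 1) / 2 + r) *
          Complex.exp (-((Real.sign y₁ : ℂ) * Complex.I * (Real.pi : ℂ) / 2) *
            (((d : ℂ) - 1) / 2 - 3 * r)) -
        Jw4 y₁ (((d : ℂ) - 1) / 2 + r) (-((d : ℂ) - 1) / 2 + r) (-2 * r))) := by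
  have hY : 0 < |8 * Real.pi ^ 3 * y₁| := abs_pos.2 (by positivity)
  have hx : -8 * (Real.pi : ℂ) ^ 3 * Complex.I * (y₁ : ℂ) =
      -(I * (Real.sign y₁ : ℂ)) * (|8 * Real.pi ^ 3 * y₁| : ℝ) := by
    have : 8 * Real.pi ^ 3 * y₁ = Real.sign y₁ * |8 * Real.pi ^ 3 * y₁| := by
      rw [abs_mul, abs_of_pos (by positivity : 0 < 8 * Real.pi ^ 3)]
      rcases hy.lt_or_gt with h | h
      · rw [Real.sign_of_neg h, abs_of_neg h]; ring
      · rw [Real.sign_of_pos h, abs_of_pos h]; ring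
    have h := congrArg (fun z : ℝ => (z : ℂ)) this
    simp only [Complex.ofReal_mul _ |8 * Real.pi ^ 3 * y₁|] at h
    push_cast at h ⊢
    linear_combination (-I) * h
  have hε : Real.sign y₁ = 1 ∨ Real.sign y₁ = -1 := (Real.sign_apply_eq_of_ne_zero _ hy).symm
  have hε' : |Real.sign y₁| = 1 := by rcases hε with h | h <;> simp [h]
  have hs' : Complex.sin (π * (((d : ℂ) - 1) / 2 - 3 * r)) =
      -Complex.sin (π * (3 * r - ((d : ℂ) - 1) / 2)) := by
    rw [← Complex.sin_neg]; ring_nf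
  have hA := ((summable_Jw4_term (-8 * (Real.pi : ℂ) ^ 3 * Complex.I * (y₁ : ℂ))
    (((d : ℂ) - 1) / 2 + r) (-((d : ℂ) - 1) / 2 + r) (-2 * r)).hasSum.mul_left
      (((|8 * Real.pi ^ 3 * y₁| : ℝ) : ℂ) ^ (1 - (-2 * r)))).mul_left
      (π / Complex.sin (π * (((d : ℂ) - 1) / 2 - 3 * r)))
  have hB := ((summable_Jw4_term (-8 * (Real.pi : ℂ) ^ 3 * Complex.I * (y₁ : ℂ))
    (-2 * r) (((d : ℂ) - 1) / 2 + r) (-((d : ℂ) - 1) / 2 + r)).hasSum.mul_left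
      (((|8 * Real.pi ^ 3 * y₁| : ℝ) : ℂ) ^ (1 - (-((d : ℂ) - 1) / 2 + r)))).mul_left
      (π / Complex.sin (π * (3 * r - ((d : ℂ) - 1) / 2)) *
        Complex.exp (-((Real.sign y₁ : ℂ) * I * (π : ℂ) / 2) * (((d : ℂ) - 1) / 2 - 3 * r)))
  rw [← Jw4] at hA hB
  simp only [hx] at hA hB
  simp only [← residueA_eq d hY hε (by rw [hs']; exact neg_ne_zero.2 hs)] at hA
  simp only [← residueB_eq d hY hε hs] at hB
  have h := tendsto_nhds_unique (tendsto_sum_residues d hd hr0 hr1 hY hε')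
    (((hA.tendsto_sum_nat.comp (tendsto_add_atTop_nat (1 + (d - 1) / 2))).add
      (hB.tendsto_sum_nat.comp (tendsto_add_atTop_nat 1))).const_mul (2 * π : ℂ) |>.congr
        fun j => by simp only [Function.comp, add_assoc])
  rw [h, hs', div_neg]
  ring

theorem cos_eq_neg_one_pow_mul_sin (d : ℕ) (r : ℂ) :
    Complex.cos ((π : ℂ) * ((d : ℂ) / 2 + 3 * r)) =
      (-1) ^ d * Complex.sin (π * (3 * r - ((d : ℂ) - 1) / 2)) := by
  rw [show (π : ℂ) * ((d : ℂ) / 2 + 3 * r) = π * (3 * r - d / 2) + d * π by ring,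
    Complex.cos_antiperiodic.add_nat_mul_eq, show (π : ℂ) * (3 * r - ((d : ℂ) - 1) / 2) =
      π * (3 * r - d / 2) + π / 2 by ring, Complex.sin_add_pi_div_two]

theorem sin_pi_mul_three_mul_sub_ne_zero (d : ℕ) {r : ℂ} (hr0 : 0 < r.re) (hr1 : r.re < 1 / 6) :
    Complex.sin (π * (3 * r - ((d : ℂ) - 1) / 2)) ≠ 0 := fun h => by
  obtain ⟨k, hk⟩ := Complex.sin_eq_zero_iff.1 h
  have hpi : (π : ℂ) ≠ 0 := by exact_mod_cast Real.pi_ne_zero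
  have h1 : 3 * r - ((d : ℂ) - 1) / 2 = k := mul_left_cancel₀ hpi (by rw [hk]; ring)
  have h2 := congrArg Complex.re h1
  refine intCast_ne_of_mem_Ioo (x := 6 * r.re) (by linarith) (by linarith) (2 * k + (d - 1)) ?_
  simp at h2
  push_cast
  linarith

/-- The Mellin-Barnes representation of the `w₄` Kuznetsov kernel, the contour `Re s = 0`
being parametrized as `s = it`, `t ∈ ℝ`. -/
theorem w4_kernel_MellinBarnes (d : ℕ) (hd : 2 ≤ d) (r : ℂ) (hr0 : 0 < r.re)
    (hr1 : r.re < 1 / 6) (y₁ : ℝ) (hy : y₁ ≠ 0) :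
    (-(Real.sign y₁ : ℂ) * Complex.I) ^ d *
        Jw4 y₁ (-2 * r) (((d : ℂ) - 1) / 2 + r) (-((d : ℂ) - 1) / 2 + r) *
        Complex.exp (-((Real.sign y₁ : ℂ) * Complex.I * (Real.pi : ℂ) / 2) *
          (((d : ℂ) - 1) / 2 - 3 * r)) -
      (-(Real.sign y₁ : ℂ) * Complex.I) ^ d *
        Jw4 y₁ (((d : ℂ) - 1) / 2 + r) (-((d : ℂ) - 1) / 2 + r) (-2 * r) =
    4 * (Real.pi : ℂ) * Complex.cos ((Real.pi : ℂ) * ((d : ℂ) / 2 + 3 * r)) *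
      (((Real.sign y₁ : ℂ) * Complex.I) ^ d / (4 * (Real.pi : ℂ) ^ 2)) *
      (((2 * Real.pi : ℝ) : ℂ))⁻¹ *
      ∫ t : ℝ,
        ((|8 * Real.pi ^ 3 * y₁| : ℝ) : ℂ) ^ (1 - r - Complex.I * t) *
          Q d (Complex.I * t) * Complex.Gamma (Complex.I * t + 3 * r) *
            Complex.exp ((Real.sign y₁ : ℂ) * (Complex.I * (Real.pi : ℂ) / 2) *
              (Complex.I * t + 3 * r)) := by
  have hs := sin_pi_mul_three_mul_sub_ne_zero d hr0 hr1
  have hpi : (π : ℂ) ≠ 0 := by exact_mod_cast Real.pi_ne_zero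
  have hint := integral_mellinBarnesIntegrand_eq d hd hr0 hr1 hy hs
  have e : ∀ t : ℝ, mellinBarnesIntegrand d r |8 * Real.pi ^ 3 * y₁| (Real.sign y₁)
      ((0 : ℝ) + t * I) = ((|8 * Real.pi ^ 3 * y₁| : ℝ) : ℂ) ^ (1 - r - Complex.I * t) *
          Q d (Complex.I * t) * Complex.Gamma (Complex.I * t + 3 * r) *
            Complex.exp ((Real.sign y₁ : ℂ) * (Complex.I * (Real.pi : ℂ) / 2) *
              (Complex.I * t + 3 * r)) := fun t => by
    rw [mellinBarnesIntegrand, Complex.ofReal_zero, zero_add, mul_comm (t : ℂ) I]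
  simp only [e] at hint
  rw [hint, cos_eq_neg_one_pow_mul_sin, neg_mul, neg_pow]
  push_cast
  generalize Complex.sin (π * (3 * r - ((d : ℂ) - 1) / 2)) = S at hs ⊢
  field_simp
end

section
/- Let d ≥ 2 be an integer, let r ∈ ℂ with 6r ∉ ℤ, let y₁, y₂ ∈ ℝ ∖ {0}, and set μ = (μ₁,μ₂,μ₃) := ((d−1)/2+r, −(d−1)/2+r, −2r). Then J_{wl}((y₁,y₂),(μ₂,μ₁,μ₃)) = sgn(y₂)^{d−1} · J_{wl}((y₁,y₂),(μ₁,μ₂,μ₃)). -/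
open Complex Real

/-- The power-series solution `J_{w_l}(y, a)`. Mathlib's `Complex.Gamma` vanishes at the
nonpositive integers, so the reciprocals of `Γ` at its poles are `0` as required. -/
noncomputable def Jwl (y₁ y₂ : ℝ) (a₁ a₂ a₃ : ℂ) : ℂ :=
  ((|4 * Real.pi ^ 2 * y₁| : ℝ) : ℂ) ^ (1 - a₃) *
    ((|4 * Real.pi ^ 2 * y₂| : ℝ) : ℂ) ^ (1 + a₁) *
    ∑' n : ℕ × ℕ,
      Complex.Gamma ((n.1 : ℂ) + (n.2 : ℂ) + a₁ - a₃ + 1) *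
        ((4 * Real.pi ^ 2 * y₁ : ℝ) : ℂ) ^ n.1 * ((4 * Real.pi ^ 2 * y₂ : ℝ) : ℂ) ^ n.2 *
        ((Complex.Gamma ((n.1 : ℂ) + a₁ - a₃ + 1) * Complex.Gamma ((n.2 : ℂ) + a₁ - a₁ + 1))⁻¹ *
          (Complex.Gamma ((n.1 : ℂ) + a₂ - a₃ + 1) * Complex.Gamma ((n.2 : ℂ) + a₁ - a₂ + 1))⁻¹ *
          (Complex.Gamma ((n.1 : ℂ) + a₃ - a₃ + 1) * Complex.Gamma ((n.2 : ℂ) + a₁ - a₃ + 1))⁻¹)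

/-- A positive power of a real number can be absorbed into a complex power of its absolute value,
at the cost of a sign. -/
lemma abs_cpow_mul_pow (x : ℝ) (hx : x ≠ 0) (c : ℂ) (k : ℕ) :
    ((|x| : ℝ) : ℂ) ^ c * ((x : ℝ) : ℂ) ^ k =
      (Real.sign x : ℂ) ^ k * ((|x| : ℝ) : ℂ) ^ (c + k) := by
  have habs : ((|x| : ℝ) : ℂ) ≠ 0 := by exact_mod_cast abs_ne_zero.mpr hx
  have hsign : (x : ℂ) = (Real.sign x : ℂ) * ((|x| : ℝ) : ℂ) := by
    rcases lt_or_gt_of_ne hx with h | h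
    · simp [Real.sign_of_neg h, abs_of_neg h]
    · simp [Real.sign_of_pos h, abs_of_pos h]
  rw [Complex.cpow_add _ _ habs, Complex.cpow_natCast]
  conv_lhs => rw [hsign, mul_pow]
  ring

/-- The `w₂` symmetry of `Jwl` whenever the first two parameters differ by a natural number. -/
lemma Jwl_swap_of_eq_add_natCast (k : ℕ) (a b c : ℂ) (hab : b = a + k) (y₁ y₂ : ℝ)
    (hy₂ : y₂ ≠ 0) :
    Jwl y₁ y₂ a b c = (Real.sign y₂ : ℂ) ^ k * Jwl y₁ y₂ b a c := by
  subst hab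
  have hpi : 0 < 4 * Real.pi ^ 2 := by positivity
  have hsign : Real.sign (4 * Real.pi ^ 2 * y₂) = Real.sign y₂ := by
    rcases lt_or_gt_of_ne hy₂ with h | h
    · rw [Real.sign_of_neg h, Real.sign_of_neg (mul_neg_of_pos_of_neg hpi h)]
    · rw [Real.sign_of_pos h, Real.sign_of_pos (mul_pos hpi h)]
  have hpow := abs_cpow_mul_pow (4 * Real.pi ^ 2 * y₂) (mul_ne_zero hpi.ne' hy₂) (1 + a) k
  rw [hsign] at hpow
  have hinj : Function.Injective fun n : ℕ × ℕ => (n.1, n.2 + k) := by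
    rintro ⟨m, n⟩ ⟨m', n'⟩ h
    simpa using h
  unfold Jwl
  rw [← hinj.tsum_eq]
  · rw [← add_assoc 1 a (k : ℂ)]
    have hcombine : ∀ {P Q S Q' Y A B : ℂ}, Q * Y = S * Q' → A = Y * B →
        P * Q * A = S * (P * Q' * B) := by
      intro P Q S Q' Y A B hQ hA
      linear_combination P * Q * hA + P * B * hQ
    refine hcombine hpow ?_
    rw [← tsum_mul_left]
    refine tsum_congr fun n => ?_
    rw [pow_add]
    push_cast
    rw [show (n.1 : ℂ) + (n.2 + k) + a - c + 1 = n.1 + n.2 + (a + k) - c + 1 by ring,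
      show (n.2 : ℂ) + k + a - a + 1 = n.2 + (a + k) - a + 1 by ring,
      show (n.2 : ℂ) + k + a - (a + k) + 1 = n.2 + (a + k) - (a + k) + 1 by ring,
      show (n.2 : ℂ) + k + a - c + 1 = n.2 + (a + k) - c + 1 by ring]
    simp only [mul_inv]
    ring
  · rintro ⟨m, n⟩ h
    by_cases hkn : k ≤ n
    · exact ⟨(m, n - k), by simp [hkn]⟩
    · refine absurd ?_ h
      have harg : (n : ℂ) + a - (a + k) + 1 = -((k - n - 1 : ℕ) : ℂ) := by
        rw [Nat.cast_sub (by omega), Nat.cast_sub (by omega)]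
        push_cast
        ring
      simp [harg, Complex.Gamma_neg_nat_eq_zero]

/-- The `w₂` symmetry relation for `J_{w_l}` at `μ = μ(r)`. -/
theorem Jwl_w2_relation (d : ℕ) (hd : 2 ≤ d) (r : ℂ) (hr : ∀ n : ℤ, 6 * r ≠ (n : ℂ))
    (y₁ y₂ : ℝ) (hy₁ : y₁ ≠ 0) (hy₂ : y₂ ≠ 0) :
    Jwl y₁ y₂ (-((d : ℂ) - 1) / 2 + r) (((d : ℂ) - 1) / 2 + r) (-2 * r) =
      (Real.sign y₂ : ℂ) ^ (d - 1) *
        Jwl y₁ y₂ (((d : ℂ) - 1) / 2 + r) (-((d : ℂ) - 1) / 2 + r) (-2 * r) := by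
  refine Jwl_swap_of_eq_add_natCast (d - 1) _ _ _ ?_ y₁ y₂ hy₂
  rw [Nat.cast_sub (by omega)]
  push_cast
  ring
end

section
/- Let d ≥ 2 be an integer, let r ∈ ℂ with 6r ∉ ℤ, let y₁, y₂ ∈ ℝ ∖ {0}, and set μ = (μ₁,μ₂,μ₃) := ((d−1)/2+r, −(d−1)/2+r, −2r). Then J_{wl}((y₁,y₂),(μ₃,μ₂,μ₁)) = sgn(y₁)^{d−1} · J_{wl}((y₁,y₂),(μ₃,μ₁,μ₂)). -/
open Complex Real

/-- The shift `(k, l) ↦ (k + m, l)` is injective. -/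
theorem injective_shift_fst (m : ℕ) :
    Function.Injective (fun n : ℕ × ℕ => (n.1 + m, n.2)) := by
  rintro ⟨a, b⟩ ⟨c, e⟩ h
  simpa using h

/-- A double series whose terms vanish for first index below `m` can be shifted by `m`. -/
theorem tsum_shift_fst (m : ℕ) (f : ℕ × ℕ → ℂ) (hf : ∀ n : ℕ × ℕ, n.1 < m → f n = 0) :
    ∑' n, f n = ∑' n : ℕ × ℕ, f (n.1 + m, n.2) := by
  refine ((injective_shift_fst m).tsum_eq fun n hn => ?_).symm
  have hmn : m ≤ n.1 := by
    by_contra! h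
    exact hn (hf n h)
  exact ⟨(n.1 - m, n.2), by simp [Nat.sub_add_cancel hmn]⟩

theorem abs_cpow_mul_pow_s12 (Y : ℝ) (hY : Y ≠ 0) (m : ℕ) (s : ℂ) :
    ((|Y| : ℝ) : ℂ) ^ s * (Y : ℂ) ^ m =
      (Real.sign Y : ℂ) ^ m * ((|Y| : ℝ) : ℂ) ^ (s + m) := by
  have h : ((|Y| : ℝ) : ℂ) ≠ 0 := by exact_mod_cast abs_ne_zero.mpr hY
  have hs : (Y : ℂ) = (Real.sign Y : ℂ) * ((|Y| : ℝ) : ℂ) := by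
    rcases hY.lt_or_gt with h | h
    · simp [Real.sign_of_neg h, abs_of_neg h]
    · simp [Real.sign_of_pos h, abs_of_pos h]
  rw [Complex.cpow_add _ _ h, Complex.cpow_natCast]
  have hp : (Y : ℂ) ^ m = (Real.sign Y : ℂ) ^ m * ((|Y| : ℝ) : ℂ) ^ m := by
    rw [← mul_pow, ← hs]
  rw [hp]
  ring

theorem sign_four_pi_sq_mul (y : ℝ) : Real.sign (4 * Real.pi ^ 2 * y) = Real.sign y := by
  have hp : 0 < 4 * Real.pi ^ 2 := by positivity
  rcases lt_trichotomy y 0 with h | rfl | h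
  · rw [Real.sign_of_neg h, Real.sign_of_neg (mul_neg_of_pos_of_neg hp h)]
  · simp
  · rw [Real.sign_of_pos h, Real.sign_of_pos (mul_pos hp h)]

/-- If `a₃ - a₂ = m` is a natural number, exchanging `a₂` and `a₃` multiplies `Jwl` by
`sign y₁ ^ m`. -/
theorem Jwl_swap (m : ℕ) (y₁ y₂ : ℝ) (hy₁ : y₁ ≠ 0) (a b : ℂ) :
    Jwl y₁ y₂ a b (b + m) = (Real.sign y₁ : ℂ) ^ m * Jwl y₁ y₂ a (b + m) b := by
  have hY : 4 * Real.pi ^ 2 * y₁ ≠ 0 := by positivity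
  have hpow := abs_cpow_mul_pow_s12 _ hY m (1 - (b + m))
  rw [sign_four_pi_sq_mul, show (1 - (b + m) + m : ℂ) = 1 - b by ring] at hpow
  unfold Jwl
  rw [tsum_shift_fst m]
  · generalize 4 * Real.pi ^ 2 * y₁ = Y at *
    generalize 4 * Real.pi ^ 2 * y₂ = Z at *
    have h_regroup : ∀ s A B S : ℂ, s * (A * B * S) = s * A * B * S := fun _ _ _ _ => by ring
    have h_move : ∀ A B C S : ℂ, A * B * C * S = A * C * (B * S) := fun _ _ _ _ => by ring
    rw [h_regroup, ← hpow, h_move, ← tsum_mul_left (a := (Y : ℂ) ^ m)]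
    congr 1
    refine tsum_congr fun n => ?_
    push_cast
    rw [show (n.1 + m + n.2 + a - (b + m) + 1 : ℂ) = n.1 + n.2 + a - b + 1 by ring,
      show (n.1 + m + a - (b + m) + 1 : ℂ) = n.1 + a - b + 1 by ring,
      show (n.1 + m + b - (b + m) + 1 : ℂ) = n.1 + b - b + 1 by ring,
      show (n.1 + m + (b + m) - (b + m) + 1 : ℂ) = n.1 + (b + m) - b + 1 by ring]
    simp only [mul_inv, pow_add]
    ring
  · intro n hn
    have h : Complex.Gamma ((n.1 : ℂ) + b - (b + m) + 1) = 0 := by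
      obtain ⟨k, rfl⟩ := Nat.exists_eq_add_of_lt hn
      rw [← Complex.Gamma_neg_nat_eq_zero k]
      congr 1
      push_cast
      ring
    simp [h]

/-- The `w_l` symmetry relation for `J_{w_l}` at `μ = μ(r)`. -/
theorem Jwl_wl_relation (d : ℕ) (hd : 2 ≤ d) (r : ℂ) (hr : ∀ n : ℤ, 6 * r ≠ (n : ℂ))
    (y₁ y₂ : ℝ) (hy₁ : y₁ ≠ 0) (hy₂ : y₂ ≠ 0) :
    Jwl y₁ y₂ (-2 * r) (-((d : ℂ) - 1) / 2 + r) (((d : ℂ) - 1) / 2 + r) =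
      (Real.sign y₁ : ℂ) ^ (d - 1) *
        Jwl y₁ y₂ (-2 * r) (((d : ℂ) - 1) / 2 + r) (-((d : ℂ) - 1) / 2 + r) := by
  have h : ((d : ℂ) - 1) / 2 + r = (-((d : ℂ) - 1) / 2 + r) + ((d - 1 : ℕ) : ℂ) := by
    rw [Nat.cast_sub (by omega)]
    push_cast
    ring
  rw [h]
  exact Jwl_swap (d - 1) y₁ y₂ hy₁ _ _
end

section
/- Let d ≥ 2 be an integer, let r ∈ ℂ with 6r ∉ ℤ, let y₁ ∈ ℝ ∖ {0}, and set μ = (μ₁,μ₂,μ₃) := ((d−1)/2+r, −(d−1)/2+r, −2r). Then J_{w₄}(y₁,(μ₃,μ₁,μ₂)) = (i·sgn(y₁))^{d−1} · J_{w₄}(y₁,(μ₂,μ₃,μ₁)). -/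
open Complex Real

/-- A series whose first `k` terms vanish equals its shift by `k`, without summability. -/
theorem tsum_eq_tsum_add_of_eq_zero {f : ℕ → ℂ} {k : ℕ} (hf : ∀ n < k, f n = 0) :
    ∑' n, f n = ∑' n, f (n + k) := by
  refine ((add_left_injective k).tsum_eq fun n hn => ?_).symm
  have hkn : k ≤ n := not_lt.mp fun h => hn (hf n h)
  exact ⟨n - k, Nat.sub_add_cancel hkn⟩

/-- The `w₅` symmetry relation for `J_{w₄}` at `μ = μ(r)`. -/
theorem Jw4_w5_relation (d : ℕ) (hd : 2 ≤ d) (r : ℂ) (hr : ∀ n : ℤ, 6 * r ≠ (n : ℂ))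
    (y₁ : ℝ) (hy₁ : y₁ ≠ 0) :
    Jw4 y₁ (-2 * r) (((d : ℂ) - 1) / 2 + r) (-((d : ℂ) - 1) / 2 + r) =
      (Complex.I * (Real.sign y₁ : ℂ)) ^ (d - 1) *
        Jw4 y₁ (-((d : ℂ) - 1) / 2 + r) (-2 * r) (((d : ℂ) - 1) / 2 + r) := by
  obtain ⟨k, rfl⟩ : ∃ k, d = k + 1 := ⟨d - 1, by omega⟩
  have hX : ((|8 * Real.pi ^ 3 * y₁| : ℝ) : ℂ) ≠ 0 := by
    have : 8 * Real.pi ^ 3 * y₁ ≠ 0 := by positivity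
    exact_mod_cast abs_ne_zero.mpr this
  have hz : Complex.I * (Real.sign y₁ : ℂ) * (-8 * (Real.pi : ℂ) ^ 3 * Complex.I * (y₁ : ℂ)) =
      ((|8 * Real.pi ^ 3 * y₁| : ℝ) : ℂ) := by
    have habs : |8 * Real.pi ^ 3 * y₁| = 8 * Real.pi ^ 3 * (Real.sign y₁ * y₁) := by
      rw [abs_mul, abs_of_pos (by positivity : 0 < 8 * Real.pi ^ 3)]
      rcases hy₁.lt_or_gt with h | h
      · rw [abs_of_neg h, Real.sign_of_neg h]; ring
      · rw [abs_of_pos h, Real.sign_of_pos h]; ring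
    rw [habs]
    push_cast
    linear_combination (-8 * (Real.pi : ℂ) ^ 3 * Real.sign y₁ * y₁) * Complex.I_mul_I
  simp only [Jw4, Nat.add_sub_cancel]
  push_cast
  rw [tsum_eq_tsum_add_of_eq_zero (k := k) (f := fun n : ℕ =>
    (-8 * (Real.pi : ℂ) ^ 3 * Complex.I * (y₁ : ℂ)) ^ n *
      ((n.factorial : ℂ) *
        Complex.Gamma ((n : ℂ) + 1 + (-((k : ℂ) + 1 - 1) / 2 + r) - (((k : ℂ) + 1 - 1) / 2 + r)) *
        Complex.Gamma ((n : ℂ) + 1 + -2 * r - (((k : ℂ) + 1 - 1) / 2 + r)))⁻¹)]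
  · have hpow : ((|8 * Real.pi ^ 3 * y₁| : ℝ) : ℂ) ^ (1 - (-((k : ℂ) + 1 - 1) / 2 + r)) =
        ((|8 * Real.pi ^ 3 * y₁| : ℝ) : ℂ) ^ (1 - (((k : ℂ) + 1 - 1) / 2 + r)) *
          ((|8 * Real.pi ^ 3 * y₁| : ℝ) : ℂ) ^ k := by
      rw [← Complex.cpow_natCast _ k, ← Complex.cpow_add _ _ hX]
      congr 1
      ring
    rw [hpow, ← hz, mul_pow, hz, mul_assoc, mul_assoc, mul_assoc, mul_left_comm]
    congr 2
    rw [← tsum_mul_left]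
    congr 1
    ext n
    have h₁ : ((n + k : ℕ) : ℂ) + 1 + (-((k : ℂ) + 1 - 1) / 2 + r) -
        (((k : ℂ) + 1 - 1) / 2 + r) = n + 1 := by push_cast; ring
    have h₂ : (n : ℂ) + 1 + (((k : ℂ) + 1 - 1) / 2 + r) - (-((k : ℂ) + 1 - 1) / 2 + r) =
        ((n + k : ℕ) : ℂ) + 1 := by push_cast; ring
    have h₃ : ((n + k : ℕ) : ℂ) + 1 + -2 * r - (((k : ℂ) + 1 - 1) / 2 + r) =
        n + 1 + -2 * r - (-((k : ℂ) + 1 - 1) / 2 + r) := by push_cast; ring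
    rw [h₁, h₂, h₃, Complex.Gamma_nat_eq_factorial, Complex.Gamma_nat_eq_factorial, pow_add]
    ring
  · intro n hn
    have h : (n : ℂ) + 1 + (-((k : ℂ) + 1 - 1) / 2 + r) - (((k : ℂ) + 1 - 1) / 2 + r) =
        -((k - (n + 1) : ℕ) : ℂ) := by
      rw [Nat.cast_sub hn]
      push_cast
      ring
    simp only [h, Complex.Gamma_neg_nat_eq_zero, mul_zero, zero_mul, inv_zero]
end
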